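/- arXiv:1311.5756 — 4 statements merged into one kernel-verified Lean document; each statement's English description precedes it below -/
import Mathlib

section
/- (Corollary 4.4, converse direction.) Fix 1 < p < ∞. If w is a weight such that w^{1−p} belongs to A_p ∩ RH_∞, then w belongs to A_1, and [w]_{A_1} ≤ ([w^{1−p}]_{A_p} · [w^{1−p}]_{RH_∞})^{1/(p−1)}. -/
open MeasureTheory

/-- The collection of open balls `B(x, ρ)` (with `ρ > 0`) such that the doubled ball
`B(x, 2ρ)` is contained in `Ω`. -/
def ballsIn {n : ℕ} (Ω : Set (EuclideanSpace ℝ (Fin n))) :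
    Set (Set (EuclideanSpace ℝ (Fin n))) :=
  {B | ∃ x ρ, 0 < ρ ∧ B = Metric.ball x ρ ∧ Metric.ball x (2 * ρ) ⊆ Ω}

/-- A weight on `Ω`: a measurable function that is positive a.e. on `Ω`. -/
def IsWeight {n : ℕ} (Ω : Set (EuclideanSpace ℝ (Fin n)))
    (w : EuclideanSpace ℝ (Fin n) → ℝ) : Prop :=
  Measurable w ∧ ∀ᵐ x ∂volume, x ∈ Ω → 0 < w x

/-- The `p`-mean of `w` over `B`, for an extended-real exponent `p`. -/
noncomputable def pMean {n : ℕ} (w : EuclideanSpace ℝ (Fin n) → ℝ) (p : EReal)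
    (B : Set (EuclideanSpace ℝ (Fin n))) : ℝ :=
  if p = ⊤ then essSup w (volume.restrict B)
  else if p = ⊥ then essInf w (volume.restrict B)
  else if p = 0 then Real.exp (⨍ x in B, Real.log (w x))
  else (⨍ x in B, (w x) ^ p.toReal) ^ (1 / p.toReal)

open Classical in
/-- Finiteness of the `p`-mean of `w` over `B`. -/
def MeanFinite {n : ℕ} (w : EuclideanSpace ℝ (Fin n) → ℝ) (p : EReal)
    (B : Set (EuclideanSpace ℝ (Fin n))) : Prop :=
  if p = ⊤ then ∃ M : ℝ, ∀ᵐ x ∂(volume.restrict B), w x ≤ M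
  else if p = ⊥ then ∃ m : ℝ, ∀ᵐ x ∂(volume.restrict B), m ≤ w x
  else if p = 0 then IntegrableOn (fun x => Real.log (w x)) B
  else IntegrableOn (fun x => (w x) ^ p.toReal) B

/-- `w ∈ RC(r, s, C)` over `Ω`: for every admissible ball the `r`- and `s`-means are finite
and `w(s,B) ≤ C · w(r,B)`. -/
def MemRC {n : ℕ} (Ω : Set (EuclideanSpace ℝ (Fin n)))
    (w : EuclideanSpace ℝ (Fin n) → ℝ) (r s : EReal) (C : ℝ) : Prop :=
  ∀ B ∈ ballsIn Ω, MeanFinite w r B ∧ MeanFinite w s B ∧ pMean w s B ≤ C * pMean w r B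

/-- `w ∈ RC(r,s) = ⋃_{C ≥ 1} RC(r,s,C)`. -/
def InRC {n : ℕ} (Ω : Set (EuclideanSpace ℝ (Fin n)))
    (w : EuclideanSpace ℝ (Fin n) → ℝ) (r s : EReal) : Prop :=
  ∃ C : ℝ, 1 ≤ C ∧ MemRC Ω w r s C

/-- `[w]_{RC(r,s)}`, the least admissible reversal constant. -/
noncomputable def RCconst {n : ℕ} (Ω : Set (EuclideanSpace ℝ (Fin n)))
    (w : EuclideanSpace ℝ (Fin n) → ℝ) (r s : EReal) : ℝ :=
  sInf {C : ℝ | 1 ≤ C ∧ MemRC Ω w r s C}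

theorem RCconst_mem {n : ℕ} {Ω : Set (EuclideanSpace ℝ (Fin n))}
    {w : EuclideanSpace ℝ (Fin n) → ℝ} {r s : EReal} (h : InRC Ω w r s) :
    1 ≤ RCconst Ω w r s ∧ MemRC Ω w r s (RCconst Ω w r s) := by
  obtain ⟨C₀, h1, hC₀⟩ := h
  have hne : {C : ℝ | 1 ≤ C ∧ MemRC Ω w r s C}.Nonempty := ⟨C₀, h1, hC₀⟩
  have hbd : BddBelow {C : ℝ | 1 ≤ C ∧ MemRC Ω w r s C} := ⟨1, fun C hC => hC.1⟩
  have heq : {C : ℝ | 1 ≤ C ∧ MemRC Ω w r s C} =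
      Set.Ici 1 ∩ ⋂ B ∈ ballsIn Ω, {C : ℝ | pMean w s B ≤ C * pMean w r B} := by
    ext C
    simp only [Set.mem_setOf_eq, Set.mem_inter_iff, Set.mem_Ici, Set.mem_iInter]
    constructor
    · rintro ⟨h, h'⟩
      exact ⟨h, fun B hB => (h' B hB).2.2⟩
    · rintro ⟨h, h'⟩
      exact ⟨h, fun B hB => ⟨(hC₀ B hB).1, (hC₀ B hB).2.1, h' B hB⟩⟩
  have hcl : IsClosed {C : ℝ | 1 ≤ C ∧ MemRC Ω w r s C} := by
    rw [heq]
    refine isClosed_Ici.inter (isClosed_biInter fun B _ => ?_)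
    exact isClosed_le continuous_const (continuous_id.mul continuous_const)
  exact hcl.csInf_mem hne hbd

theorem memRC_main {n : ℕ} 
    {Ω : Set (EuclideanSpace ℝ (Fin n))}
    {w : EuclideanSpace ℝ (Fin n) → ℝ} (hw : IsWeight Ω w)
    {p : ℝ} (hp : 1 < p) {C D : ℝ} (hC : 1 ≤ C) (hD : 1 ≤ D)
    (h₁ : MemRC Ω (fun x => w x ^ (1 - p)) ((1 / (1 - p) : ℝ) : EReal) 1 C)
    (h₂ : MemRC Ω (fun x => w x ^ (1 - p)) 1 ⊤ D) :
    MemRC Ω w ⊥ 1 ((C * D) ^ (1 / (p - 1))) := by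
  intro B hB
  obtain ⟨f1, -, i1⟩ := h₁ B hB
  obtain ⟨-, f2, i2⟩ := h₂ B hB
  obtain ⟨x, ρ, hρ, rfl, hsub⟩ := hB
  set B := Metric.ball x ρ with hBdef
  have hBΩ : B ⊆ Ω := (Metric.ball_subset_ball (by linarith)).trans hsub
  have hp0 : 1 - p ≠ 0 := by linarith
  have hq0 : 1 / (1 - p) ≠ 0 := one_div_ne_zero hp0
  have hpos : ∀ᵐ x ∂(volume.restrict B), 0 < w x := by
    rw [ae_restrict_iff' Metric.isOpen_ball.measurableSet]
    filter_upwards [hw.2] with y hy hyB using hy (hBΩ hyB)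
  have hinv : ∀ᵐ x ∂(volume.restrict B), (w x ^ (1 - p)) ^ (1 / (1 - p)) = w x := by
    filter_upwards [hpos] with y hy
    rw [← Real.rpow_mul hy.le, mul_one_div_cancel hp0, Real.rpow_one]
  have e0 : ((1 / (1 - p) : ℝ) : EReal) ≠ 0 := by exact_mod_cast hq0
  have t1 : (1 : EReal) ≠ ⊤ := EReal.coe_ne_top 1
  have b1 : (1 : EReal) ≠ ⊥ := EReal.coe_ne_bot 1
  simp only [MeanFinite, pMean, EReal.coe_ne_top, EReal.coe_ne_bot, e0, t1, b1, one_ne_zero,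
    if_true, if_false, EReal.toReal_coe, EReal.toReal_one, Real.rpow_one, div_one,
    bot_ne_top] at f1 f2 i1 i2 ⊢
  have hint : IntegrableOn w B := f1.congr hinv
  have havg : (⨍ y in B, (w y ^ (1 - p)) ^ (1 / (1 - p))) = ⨍ y in B, w y :=
    average_congr hinv
  rw [havg, one_div_one_div] at i1
  have hB0 : volume B ≠ 0 := (Metric.measure_ball_pos volume x hρ).ne'
  have hBt : volume B ≠ ⊤ := measure_ball_lt_top.ne
  have : (ae (volume.restrict B)).NeBot := by
    rw [ae_neBot]; simpa using hB0
  set A := ⨍ y in B, w y with hA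
  have hAle : ∀ m : ℝ, (∀ᵐ y ∂(volume.restrict B), m ≤ w y) → m ≤ A := by
    intro m hm
    have h : (⨍ _ in B, m) ≤ A := by
      rw [hA, setAverage_eq, setAverage_eq]
      refine smul_le_smul_of_nonneg_left ?_ (by positivity)
      exact integral_mono_ae (integrableOn_const hBt) hint hm
    rwa [setAverage_const hB0 hBt] at h
  have hApos : 0 < A := by
    rw [hA, setAverage_eq, smul_eq_mul]
    refine mul_pos (inv_pos.2 (ENNReal.toReal_pos hB0 hBt)) ?_
    rw [integral_pos_iff_support_of_nonneg_ae (hpos.mono fun _ h => h.le) hint]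
    rw [pos_iff_ne_zero]
    intro h0
    have h1 : ∀ᵐ y ∂(volume.restrict B), w y = 0 := by
      rw [ae_iff]; exact h0
    obtain ⟨y, hy, hy'⟩ := (hpos.and h1).exists
    exact hy.ne' hy'
  have hCD : 0 < C * D := by positivity
  have key : ∀ᵐ y ∂(volume.restrict B), ((C * D) ^ (1 / (p - 1)))⁻¹ * A ≤ w y := by
    obtain ⟨M, hM⟩ := f2
    have hle : ∀ᵐ y ∂(volume.restrict B),
        w y ^ (1 - p) ≤ essSup (fun x => w x ^ (1 - p)) (volume.restrict B) :=
      ae_le_essSup ⟨M, hM⟩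
    filter_upwards [hle, hpos] with y hy hy0
    have h3 : w y ^ (1 - p) ≤ (C * D) * A ^ (1 - p) := by
      calc _ ≤ _ := hy
        _ ≤ _ := i2
        _ ≤ D * (C * A ^ (1 - p)) := by gcongr
        _ = _ := by ring
    have h4 : (C * D) * A ^ (1 - p) = (((C * D) ^ (1 / (p - 1)))⁻¹ * A) ^ (1 - p) := by
      rw [Real.mul_rpow (by positivity) hApos.le, ← Real.rpow_neg hCD.le, ← Real.rpow_mul hCD.le]
      have : -(1 / (p - 1)) * (1 - p) = 1 := by
        have : p - 1 ≠ 0 := by linarith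
        field_simp
        ring
      rw [this, Real.rpow_one]
    rw [h4] at h3
    exact (Real.rpow_le_rpow_iff_of_neg hy0 (by positivity) (by linarith)).1 h3
  refine ⟨⟨0, hpos.mono fun _ h => h.le⟩, hint, ?_⟩
  have hinf : ((C * D) ^ (1 / (p - 1)))⁻¹ * A ≤ essInf w (volume.restrict B) := by
    rw [essInf, Filter.liminf_eq]
    exact le_csSup ⟨A, fun m hm => hAle m hm⟩ key
  rwa [inv_mul_le_iff₀ (by positivity)] at hinf

/-- **Corollary 4.4, converse direction.** For `1 < p < ∞`: if `w^{1−p} ∈ A_p ∩ RH_∞`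
(where `A_p = RC(1/(1−p),1)` and `RH_∞ = RC(1,∞)`), then `w ∈ A₁ = RC(−∞,1)`, and
`[w]_{A₁} ≤ ([w^{1−p}]_{A_p} · [w^{1−p}]_{RH_∞})^{1/(p−1)}`. -/
theorem ap_rhinf_to_a1 {n : ℕ} (hn : 1 ≤ n)
    {Ω : Set (EuclideanSpace ℝ (Fin n))} (hΩ : IsOpen Ω)
    {w : EuclideanSpace ℝ (Fin n) → ℝ} (hw : IsWeight Ω w)
    {p : ℝ} (hp : 1 < p)
    (h₁ : InRC Ω (fun x => w x ^ (1 - p)) ((1 / (1 - p) : ℝ) : EReal) 1)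
    (h₂ : InRC Ω (fun x => w x ^ (1 - p)) 1 ⊤) :
    InRC Ω w ⊥ 1 ∧
    RCconst Ω w ⊥ 1
      ≤ (RCconst Ω (fun x => w x ^ (1 - p)) ((1 / (1 - p) : ℝ) : EReal) 1 *
          RCconst Ω (fun x => w x ^ (1 - p)) 1 ⊤) ^ (1 / (p - 1)) := by
  obtain ⟨hC, H₁⟩ := RCconst_mem h₁
  obtain ⟨hD, H₂⟩ := RCconst_mem h₂
  have h := memRC_main hw hp hC hD H₁ H₂
  have h1 := Real.one_le_rpow (one_le_mul_of_one_le_of_one_le hC hD)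
    (show 0 ≤ 1 / (p - 1) from one_div_nonneg.2 (by linarith))
  exact ⟨⟨_, h1, h⟩, csInf_le ⟨1, fun C hC => hC.1⟩ ⟨h1, h⟩⟩
end

section
/- (Theorem 5.2(i), reverse Hölder self-improvement of A_p.) Fix 1 < p < ∞. For every weight w ∈ A_p there exists δ > 0, depending only on the dimension n, on p, and on [w]_{A_p}, such that w ∈ RH_{1+δ}. -/
open MeasureTheory

lemma rhaux_level {α : Type*} [MeasurableSpace α] (μ : Measure α) [IsFiniteMeasure μ]
    (hμ : μ Set.univ ≠ 0) (w : α → ℝ) (q C : ℝ) (hq : 0 < q) (hC : 1 ≤ C)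
    (hpos : ∀ᵐ x ∂μ, 0 < w x) (hi : Integrable w μ) (hi2 : Integrable (fun x => w x ^ (-q)) μ)
    (h : ⨍ x, w x ∂μ ≤ C * (⨍ x, w x ^ (-q) ∂μ) ^ (-1 / q)) (s t : ℝ) (hs : 0 < s) (ht : 0 < t)
    (hta : ENNReal.ofReal t * μ Set.univ ≤ ∫⁻ x, ENNReal.ofReal (w x) ∂μ) :
    μ {x | w x ≤ s * t} ≤ ENNReal.ofReal ((C * s) ^ q) * μ Set.univ := by
  have hV : 0 < μ.real Set.univ := ENNReal.toReal_pos hμ (measure_ne_top _ _)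
  have hVeq : μ Set.univ = ENNReal.ofReal (μ.real Set.univ) := by simp
  rw [← ofReal_integral_eq_lintegral_ofReal hi (hpos.mono fun x hx => hx.le), hVeq,
    ← ENNReal.ofReal_mul ht.le, ENNReal.ofReal_le_ofReal_iff
      (integral_nonneg_of_ae (hpos.mono fun x hx => hx.le))] at hta
  have hnn : 0 ≤ᵐ[μ] fun x => w x ^ (-q) := hpos.mono fun x hx => (Real.rpow_pos_of_pos hx _).le
  have hmk := mul_meas_ge_le_integral_of_nonneg hnn hi2 ((s * t) ^ (-q))
  have hsub : μ {x | w x ≤ s * t} ≤ μ {x | (s * t) ^ (-q) ≤ w x ^ (-q)} := by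
    apply measure_mono_ae
    filter_upwards [hpos] with x hx hx2
    exact Real.rpow_le_rpow_of_nonpos hx hx2 (by linarith)
  have hsub' : μ.real {x | w x ≤ s * t} ≤ μ.real {x | (s * t) ^ (-q) ≤ w x ^ (-q)} :=
    ENNReal.toReal_mono (measure_ne_top _ _) hsub
  set m := ⨍ x, w x ^ (-q) ∂μ with hm
  have hmi : ∫ x, w x ^ (-q) ∂μ = μ.real Set.univ * m := by
    rw [hm, average_eq, smul_eq_mul]; field_simp
  have hwi : ∫ x, w x ∂μ = μ.real Set.univ * ⨍ x, w x ∂μ := by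
    rw [average_eq, smul_eq_mul]; field_simp
  have hm0 : 0 ≤ m := by
    have : 0 ≤ μ.real Set.univ * m := hmi ▸ integral_nonneg_of_ae hnn
    exact nonneg_of_mul_nonneg_right this hV
  have htm : t ≤ C * m ^ (-1 / q) := by
    refine le_trans ?_ h
    rw [hwi] at hta
    nlinarith
  have hmpos : 0 < m := by
    rcases hm0.eq_or_lt with h0 | h0
    · rw [← h0, Real.zero_rpow (by simp [hq.ne'])] at htm
      linarith
    · exact h0
  have hmle : m ≤ (C / t) ^ q := by
    have h1 : m ^ (1 / q) ≤ C / t := by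
      rw [le_div_iff₀ ht]
      have : m ^ (-1 / q) = (m ^ (1 / q))⁻¹ := by
        rw [← Real.rpow_neg hm0]; congr 1; ring
      rw [this, ← div_eq_mul_inv, le_div_iff₀ (by positivity)] at htm
      linarith
    calc m = (m ^ (1 / q)) ^ q := by
          rw [← Real.rpow_mul hm0]; field_simp; simp
      _ ≤ _ := Real.rpow_le_rpow (by positivity) h1 hq.le
  rw [hVeq, ← ENNReal.ofReal_mul (by positivity)]
  rw [← ENNReal.ofReal_toReal (measure_ne_top μ {x | w x ≤ s * t})]
  apply ENNReal.ofReal_le_ofReal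
  change μ.real _ ≤ _
  have h2 : (s * t) ^ (-q) * μ.real {x | w x ≤ s * t} ≤ μ.real Set.univ * (C / t) ^ q := by
    calc _ ≤ _ := mul_le_mul_of_nonneg_left hsub' (by positivity)
      _ ≤ _ := hmk
      _ ≤ _ := by rw [hmi]; exact mul_le_mul_of_nonneg_left hmle hV.le
  rw [Real.rpow_neg (by positivity), ← div_eq_inv_mul, div_le_iff₀ (by positivity)] at h2
  calc _ ≤ _ := h2
    _ = _ := by
      rw [mul_assoc, ← Real.mul_rpow (by positivity) (by positivity), mul_comm]
      congr 2; field_simp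

lemma rhaux_doubling {α : Type*} [MeasurableSpace α] (μ : Measure α)
    (w : α → ℝ) (hw : Measurable w) (A E : Set α) (hA : MeasurableSet A) (hE : MeasurableSet E)
    (hEA : E ⊆ A) (hA0 : μ A ≠ 0) (hAt : μ A ≠ ⊤) (θ s : ℝ) (hθ : 0 < θ) (hs : 0 < s)
    (hnt : ∫⁻ x in A, ENNReal.ofReal (w x) ∂μ ≠ ⊤)
    (hL : ∀ t : ℝ, 0 < t → ENNReal.ofReal t * μ A ≤ ∫⁻ x in A, ENNReal.ofReal (w x) ∂μ →
      μ (A ∩ {x | w x ≤ s * t}) ≤ ENNReal.ofReal (θ / 2) * μ A)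
    (hθE : ENNReal.ofReal θ * μ A ≤ μ E) :
    ∫⁻ x in A, ENNReal.ofReal (w x) ∂μ ≤
      ENNReal.ofReal (2 / (s * θ)) * ∫⁻ x in E, ENNReal.ofReal (w x) ∂μ := by
  set I := ∫⁻ x in A, ENNReal.ofReal (w x) ∂μ with hI
  rcases eq_or_ne I 0 with h0 | h0
  · rw [h0]; exact zero_le
  set t := I.toReal / (μ A).toReal with ht
  have hIp := ENNReal.toReal_pos h0 hnt
  have hAp := ENNReal.toReal_pos hA0 hAt
  have htp : 0 < t := div_pos hIp hAp
  have hIt : ENNReal.ofReal t * μ A = I := by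
    rw [← ENNReal.ofReal_toReal hAt, ← ENNReal.ofReal_mul htp.le, ht, div_mul_cancel₀ _ hAp.ne',
      ENNReal.ofReal_toReal hnt]
  have h1 := hL t htp hIt.le
  have hmeas : MeasurableSet {x | s * t < w x} := measurableSet_lt measurable_const hw
  have h2 : ENNReal.ofReal (θ / 2) * μ A ≤ μ (E ∩ {x | s * t < w x}) := by
    have h3 : μ E ≤ μ (E ∩ {x | s * t < w x}) + μ (A ∩ {x | w x ≤ s * t}) := by
      refine (measure_mono ?_).trans (measure_union_le _ _)
      intro x hx
      rcases lt_or_ge (s * t) (w x) with h | h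
      · exact Or.inl ⟨hx, h⟩
      · exact Or.inr ⟨hEA hx, h⟩
    have h4 : ENNReal.ofReal (θ / 2) * μ A + ENNReal.ofReal (θ / 2) * μ A = ENNReal.ofReal θ * μ A := by
      rw [← add_mul, ← ENNReal.ofReal_add (by positivity) (by positivity), add_halves]
    have h5 : ENNReal.ofReal (θ / 2) * μ A ≠ ⊤ := ENNReal.mul_ne_top ENNReal.ofReal_ne_top hAt
    refine ENNReal.le_of_add_le_add_right h5 ?_
    rw [h4]
    exact hθE.trans (h3.trans (by gcongr))
  have h6 : ENNReal.ofReal (s * t) * μ (E ∩ {x | s * t < w x}) ≤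
      ∫⁻ x in E, ENNReal.ofReal (w x) ∂μ := by
    calc _ = ∫⁻ x in E ∩ {x | s * t < w x}, ENNReal.ofReal (s * t) ∂μ := by
          rw [setLIntegral_const]
      _ ≤ ∫⁻ x in E ∩ {x | s * t < w x}, ENNReal.ofReal (w x) ∂μ := by
          apply setLIntegral_mono' (hE.inter hmeas)
          intro x hx
          exact ENNReal.ofReal_le_ofReal (le_of_lt hx.2)
      _ ≤ _ := lintegral_mono_set Set.inter_subset_left
  calc I = ENNReal.ofReal (2 / (s * θ)) * (ENNReal.ofReal (s * t) * (ENNReal.ofReal (θ / 2) * μ A)) := by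
        rw [← mul_assoc, ← mul_assoc, ← ENNReal.ofReal_mul (by positivity),
          ← ENNReal.ofReal_mul (by positivity), ← hIt]
        congr 2; field_simp
    _ ≤ _ := by gcongr; exact le_trans (by gcongr) h6

lemma rhaux_layer {α : Type*} [MeasurableSpace α] (μ : Measure α) [IsFiniteMeasure μ]
    (w : α → ℝ) (hw : Measurable w) (hpos : ∀ᵐ x ∂μ, 0 ≤ w x)
    (hi : ∫⁻ x, ENNReal.ofReal (w x) ∂μ ≠ ⊤) (K η l δ : ℝ) (hK : 0 < K) (hη : 0 < η) (hη1 : η ≤ 1)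
    (hl : 0 ≤ l) (hδ : 0 < δ) (hδ1 : δ * K * (1 / η) ^ (1 + δ) ≤ 1 / 2)
    (h : ∀ t : ℝ, l ≤ t → 0 < t → ∫⁻ x in {x | t < w x}, ENNReal.ofReal (w x) ∂μ ≤
      ENNReal.ofReal (K * t) * μ {x | η * t < w x}) :
    ∫⁻ x, ENNReal.ofReal (w x ^ (1 + δ)) ∂μ ≤
      2 * (ENNReal.ofReal (l ^ δ) * ∫⁻ x, ENNReal.ofReal (w x) ∂μ) := by
  set ν := μ.withDensity (fun x => ENNReal.ofReal (w x)) with hν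
  have hwm : Measurable (fun x => ENNReal.ofReal (w x)) := hw.ennreal_ofReal
  have hνu : ν Set.univ = ∫⁻ x, ENNReal.ofReal (w x) ∂μ := by
    rw [hν, withDensity_apply _ MeasurableSet.univ, Measure.restrict_univ]
  have hposν : ∀ᵐ x ∂ν, 0 ≤ w x := withDensity_absolutelyContinuous _ _ hpos
  -- truncated estimate
  have key : ∀ N : ℕ, ∫⁻ x, ENNReal.ofReal (w x * (min (w x) N) ^ δ) ∂μ ≤
      2 * (ENNReal.ofReal (l ^ δ) * ∫⁻ x, ENNReal.ofReal (w x) ∂μ) := by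
    intro N
    set J := ∫⁻ x, ENNReal.ofReal (w x * (min (w x) N) ^ δ) ∂μ with hJ
    have hJν : J = ∫⁻ x, ENNReal.ofReal ((min (w x) N) ^ δ) ∂ν := by
      rw [hν, lintegral_withDensity_eq_lintegral_mul _ hwm (by fun_prop)]
      apply lintegral_congr_ae
      filter_upwards [hpos] with x hx
      simp only [Pi.mul_apply]
      rw [ENNReal.ofReal_mul hx]
    have hJt : J ≠ ⊤ := by
      refine ne_top_of_le_ne_top (b := ENNReal.ofReal ((N : ℝ) ^ δ) * ∫⁻ x, ENNReal.ofReal (w x) ∂μ) 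
        (ENNReal.mul_ne_top ENNReal.ofReal_ne_top hi) ?_
      rw [← lintegral_const_mul _ hwm]
      apply lintegral_mono_ae
      filter_upwards [hpos] with x hx
      rw [← ENNReal.ofReal_mul (by positivity), mul_comm]
      apply ENNReal.ofReal_le_ofReal
      gcongr
      exact min_le_right _ _
    have e1 : J = ENNReal.ofReal δ * ∫⁻ t in Set.Ioi 0, ν {a | t < min (w a) N} * ENNReal.ofReal (t ^ (δ - 1)) := by
      rw [hJν]
      exact lintegral_rpow_eq_lintegral_meas_lt_mul ν
        (hposν.mono fun x hx => le_min hx (by positivity)) (by fun_prop) hδ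
    have e2 : ENNReal.ofReal (l ^ δ) * ν Set.univ =
        ENNReal.ofReal δ * ∫⁻ t in Set.Ioi 0, ν {a | t < l} * ENNReal.ofReal (t ^ (δ - 1)) := by
      rw [← lintegral_rpow_eq_lintegral_meas_lt_mul ν (f := fun _ => l)
        (Filter.Eventually.of_forall fun x => hl) (by fun_prop) hδ]
      simp
    have e3 : ∫⁻ x, ENNReal.ofReal ((min (w x / η) N) ^ (1 + δ)) ∂μ = 
        ENNReal.ofReal (1 + δ) * ∫⁻ t in Set.Ioi 0, μ {a | t < min (w a / η) N} * ENNReal.ofReal (t ^ (1 + δ - 1)) := by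
      exact lintegral_rpow_eq_lintegral_meas_lt_mul μ
        (hpos.mono fun x hx => le_min (by positivity) (by positivity)) (by fun_prop) (by linarith)
    have e4 : ∫⁻ x, ENNReal.ofReal ((min (w x / η) N) ^ (1 + δ)) ∂μ ≤ 
        ENNReal.ofReal ((1 / η) ^ (1 + δ)) * J := by
      rw [hJ, ← lintegral_const_mul _ (by fun_prop)]
      apply lintegral_mono_ae
      filter_upwards [hpos] with x hx
      rw [← ENNReal.ofReal_mul (by positivity)]
      apply ENNReal.ofReal_le_ofReal
      have hmn : 0 ≤ min (w x) N := le_min hx (by positivity)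
      have a1 : min (w x / η) N ≤ 1 / η * min (w x) N := by
        rcases le_total (w x) N with hh | hh
        · rw [min_eq_left hh]; refine (min_le_left _ _).trans (le_of_eq (by ring))
        · rw [min_eq_right hh]; refine (min_le_right _ _).trans ?_
          rw [one_div_mul_eq_div, le_div_iff₀ hη]
          have : (0:ℝ) ≤ N := by positivity
          nlinarith
      calc _ ≤ (1 / η * min (w x) N) ^ (1 + δ) :=
            Real.rpow_le_rpow (le_min (by positivity) (by positivity)) a1 (by linarith)
        _ = (1 / η) ^ (1 + δ) * (min (w x) N * min (w x) N ^ δ) := by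
            rw [Real.mul_rpow (by positivity) hmn, Real.rpow_add_of_nonneg hmn (by norm_num) hδ.le,
              Real.rpow_one]
        _ ≤ _ := by gcongr; exact min_le_left _ _
    have e5 : ∫⁻ t in Set.Ioi (0:ℝ), ν {a | t < min (w a) N} * ENNReal.ofReal (t ^ (δ - 1)) ≤
        (∫⁻ t in Set.Ioi (0:ℝ), ν {a | t < l} * ENNReal.ofReal (t ^ (δ - 1))) + 
        ENNReal.ofReal K * ∫⁻ t in Set.Ioi (0:ℝ), μ {a | t < min (w a / η) N} * ENNReal.ofReal (t ^ (1 + δ - 1)) := by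
      rw [← lintegral_const_mul' _ _ ENNReal.ofReal_ne_top]
      refine le_trans (setLIntegral_mono' measurableSet_Ioi (g := fun t => ν {a | t < l} * ENNReal.ofReal (t ^ (δ - 1)) + ENNReal.ofReal K * (μ {a | t < min (w a / η) N} * ENNReal.ofReal (t ^ (1 + δ - 1)))) ?_) ?_
      · intro t ht
        have ht : 0 < t := ht
        rcases lt_or_ge t l with htl | htl
        · refine le_trans ?_ le_self_add
          refine mul_le_mul_left (measure_mono ?_) _
          intro x _
          exact htl
        · refine le_trans ?_ le_add_self
          rcases lt_or_ge t N with htN | htN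
          · have s1 : {a | t < min (w a) N} = {a | t < w a} := by ext a; simp [htN]
            have s2 : {a | t < min (w a / η) N} = {a | η * t < w a} := by
              ext a; simp [htN, lt_div_iff₀ hη, mul_comm]
            rw [s1, s2, hν, withDensity_apply _ (measurableSet_lt measurable_const hw)]
            have s3 : t ^ (1 + δ - 1) = t * t ^ (δ - 1) := by
              rw [← Real.rpow_one_add' ht.le (by simp [hδ.ne'])]; congr 1; ring
            rw [s3, ENNReal.ofReal_mul ht.le]
            refine (mul_le_mul_left (h t htl ht) _).trans (le_of_eq ?_)
            rw [ENNReal.ofReal_mul hK.le]; ring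
          · have s1 : {a | t < min (w a) N} = ∅ := by ext a; simp [htN]
            rw [s1]; simp
      · rw [lintegral_add_left']
        refine AEMeasurable.mul ?_ (by fun_prop)
        apply Measurable.aemeasurable
        apply Antitone.measurable
        intro a b hab
        apply measure_mono
        intro x hx
        exact lt_of_le_of_lt hab hx
    have e6 : J ≤ ENNReal.ofReal (l ^ δ) * ν Set.univ + ENNReal.ofReal (1 / 2) * J := by
      set X := ∫⁻ t in Set.Ioi (0:ℝ), μ {a | t < min (w a / η) N} * ENNReal.ofReal (t ^ (1 + δ - 1))
      have hX : X ≤ ENNReal.ofReal ((1 / η) ^ (1 + δ)) * J := by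
        refine le_trans ?_ (e3 ▸ e4)
        refine le_mul_of_one_le_left (by simp) ?_
        rw [ENNReal.one_le_ofReal]; linarith
      calc J ≤ ENNReal.ofReal δ * (_ + ENNReal.ofReal K * X) := by
              rw [e1]; exact mul_le_mul_right e5 _
        _ = ENNReal.ofReal (l ^ δ) * ν Set.univ + ENNReal.ofReal δ * ENNReal.ofReal K * X := by
              rw [mul_add, ← e2]; ring
        _ ≤ ENNReal.ofReal (l ^ δ) * ν Set.univ + ENNReal.ofReal δ * ENNReal.ofReal K * (ENNReal.ofReal ((1 / η) ^ (1 + δ)) * J) := by gcongr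
        _ ≤ _ := by
              refine add_le_add_right ?_ _
              rw [← ENNReal.ofReal_mul hδ.le, ← mul_assoc, ← ENNReal.ofReal_mul (by positivity)]
              gcongr
    rw [hνu] at e6
    have e7 : ENNReal.ofReal (1/2) * J + ENNReal.ofReal (1/2) * J = J := by
      rw [← add_mul, ← ENNReal.ofReal_add (by norm_num) (by norm_num)]; norm_num
    have e8 : ENNReal.ofReal (1/2) * J ≤ ENNReal.ofReal (l ^ δ) * ∫⁻ x, ENNReal.ofReal (w x) ∂μ := by
      refine ENNReal.le_of_add_le_add_right (a := ENNReal.ofReal (1/2) * J) (ENNReal.mul_ne_top ENNReal.ofReal_ne_top hJt) ?_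
      rw [e7]; exact e6
    calc J = 2 * (ENNReal.ofReal (1/2) * J) := by rw [two_mul, e7]
      _ ≤ _ := by gcongr
  -- Fatou
  have hlim : ∀ᵐ x ∂μ, ENNReal.ofReal (w x ^ (1 + δ)) ≤ 
      Filter.liminf (fun N : ℕ => ENNReal.ofReal (w x * (min (w x) N) ^ δ)) Filter.atTop := by
    filter_upwards [hpos] with x hx
    refine le_of_eq (Filter.Tendsto.liminf_eq ?_).symm
    apply tendsto_const_nhds.congr'
    obtain ⟨M, hM⟩ := exists_nat_ge (w x)
    filter_upwards [Filter.eventually_ge_atTop M] with N hN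
    rw [min_eq_left (hM.trans (by exact_mod_cast hN)), Real.rpow_add_of_nonneg hx (by norm_num) hδ.le,
              Real.rpow_one]
  refine (lintegral_mono_ae hlim).trans ((lintegral_liminf_le (fun N => by fun_prop)).trans ?_)
  refine (Filter.liminf_le_liminf (Filter.Eventually.of_forall key)).trans ?_
  simp

lemma rhaux_stop {n : ℕ} [Nontrivial (EuclideanSpace ℝ (Fin n))] (x0 : EuclideanSpace ℝ (Fin n)) (ρ : ℝ) (hρ : 0 < ρ)
    (w : EuclideanSpace ℝ (Fin n) → ℝ)
    (hpos : ∀ᵐ x ∂volume.restrict (Metric.ball x0 ρ), 0 < w x)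
    (hi : IntegrableOn w (Metric.ball x0 ρ)) (t : ℝ) (ht : 0 < t)
    (htB : ∫⁻ x in Metric.ball x0 ρ, ENNReal.ofReal (w x) ≤
      ENNReal.ofReal t * volume (Metric.ball x0 ρ)) :
    ∀ᵐ y, y ∈ Metric.ball x0 ρ → t < w y → ∃ c r, 0 < r ∧ dist c x0 + r ≤ ρ ∧
      y ∈ Metric.ball c r ∧ 
      ENNReal.ofReal t * volume (Metric.ball c r) ≤ ∫⁻ x in Metric.ball c r, ENNReal.ofReal (w x) ∧
      ∫⁻ x in Metric.ball c r, ENNReal.ofReal (w x) ≤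
        ENNReal.ofReal (2 ^ n * t) * volume (Metric.ball c r) := by
  have hloc : LocallyIntegrable ((Metric.ball x0 ρ).indicator w) :=
    ((integrable_indicator_iff measurableSet_ball).2 hi).locallyIntegrable
  filter_upwards [IsUnifLocDoublingMeasure.ae_tendsto_average volume hloc 1] with y hy hyB hyt
  have hyd : dist y x0 < ρ := hyB
  set c : ℕ → EuclideanSpace ℝ (Fin n) := fun k => AffineMap.lineMap y x0 ((1/2:ℝ)^k) with hc
  set r : ℕ → ℝ := fun k => ρ * (1/2:ℝ)^k with hr
  have hr0 : ∀ k, 0 < r k := fun k => by simp only [hr]; positivity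
  have hcx : ∀ k, dist (c k) x0 + r k ≤ ρ := by
    intro k
    simp only [hc, hr, dist_lineMap_right]
    have h1 : (1/2:ℝ)^k ≤ 1 := pow_le_one₀ (by norm_num) (by norm_num)
    rw [Real.norm_of_nonneg (by linarith)]
    nlinarith
  have hcy : ∀ k, y ∈ Metric.ball (c k) (r k) := by
    intro k
    simp only [hc, hr, Metric.mem_ball, dist_left_lineMap]
    rw [Real.norm_of_nonneg (by positivity), mul_comm]
    gcongr
  have hnest : ∀ k, Metric.ball (c (k+1)) (r (k+1)) ⊆ Metric.ball (c k) (r k) := by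
    intro k
    apply Metric.ball_subset_ball'
    simp only [hc, hr, dist_lineMap_lineMap, Real.dist_eq]
    rw [pow_succ, abs_of_nonpos (by nlinarith [pow_pos (show (0:ℝ) < 1/2 by norm_num) k])]
    nlinarith [pow_pos (show (0:ℝ) < 1/2 by norm_num) k]
  have hvol : ∀ k, volume (Metric.ball (c k) (r k)) = ENNReal.ofReal (2^n) * volume (Metric.ball (c (k+1)) (r (k+1))) := by
    intro k
    rw [Measure.addHaar_ball_of_pos _ _ (hr0 _), Measure.addHaar_ball_of_pos _ _ (hr0 (k+1)), ← mul_assoc,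
      ← ENNReal.ofReal_mul (by positivity), finrank_euclideanSpace_fin, ← mul_pow]
    congr 3
    simp only [hr]; ring
  have hsub : ∀ k, Metric.ball (c k) (r k) ⊆ Metric.ball x0 ρ := fun k =>
    Metric.ball_subset_ball' (by linarith [hcx k])
  have hex : ∃ k, ENNReal.ofReal t * volume (Metric.ball (c k) (r k)) < ∫⁻ x in Metric.ball (c k) (r k), ENNReal.ofReal (w x) := by
    have hlim : Filter.Tendsto r Filter.atTop (nhdsWithin 0 (Set.Ioi 0)) := by
      rw [tendsto_nhdsWithin_iff]
      refine ⟨?_, Filter.Eventually.of_forall hr0⟩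
      have := (tendsto_pow_atTop_nhds_zero_of_lt_one (show (0:ℝ) ≤ 1/2 by norm_num) (by norm_num)).const_mul ρ
      rw [mul_zero] at this; exact this
    have h2 := hy c r hlim (Filter.Eventually.of_forall fun k => by
      rw [one_mul]; exact Metric.ball_subset_closedBall (hcy k))
    rw [Set.indicator_of_mem hyB] at h2
    obtain ⟨k, hk⟩ := (h2.eventually (lt_mem_nhds hyt)).exists
    refine ⟨k, ?_⟩
    have hae : (Metric.closedBall (c k) (r k) : Set (EuclideanSpace ℝ (Fin n))) =ᵐ[volume] Metric.ball (c k) (r k) := by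
      refine (ae_eq_of_subset_of_measure_ge Metric.ball_subset_closedBall (Measure.addHaar_closedBall_eq_addHaar_ball _ _ _).le measurableSet_ball.nullMeasurableSet ?_).symm
      exact measure_closedBall_lt_top.ne
    rw [setAverage_congr hae] at hk
    rw [setAverage_eq, setIntegral_congr_fun measurableSet_ball (g := w) (fun x hx => Set.indicator_of_mem (hsub k hx) w), smul_eq_mul] at hk
    have hV : 0 < volume.real (Metric.ball (c k) (r k)) :=
      ENNReal.toReal_pos (Metric.measure_ball_pos _ _ (hr0 k)).ne' measure_ball_lt_top.ne
    rw [← div_eq_inv_mul, lt_div_iff₀ hV] at hk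
    rw [← ofReal_integral_eq_lintegral_ofReal (hi.mono_set (hsub k)) ((ae_restrict_of_ae_restrict_of_subset (hsub k) hpos).mono fun x hx => hx.le)]
    rw [← ENNReal.ofReal_toReal (measure_ball_lt_top (μ := volume) (x := c k) (r := r k)).ne, ← ENNReal.ofReal_mul ht.le]
    exact (ENNReal.ofReal_lt_ofReal_iff_of_nonneg (by positivity)).2 hk
  classical
  obtain ⟨k, hk, hmin⟩ : ∃ k, ENNReal.ofReal t * volume (Metric.ball (c k) (r k)) < ∫⁻ x in Metric.ball (c k) (r k), ENNReal.ofReal (w x) ∧ ∀ j < k, ¬ (ENNReal.ofReal t * volume (Metric.ball (c j) (r j)) < ∫⁻ x in Metric.ball (c j) (r j), ENNReal.ofReal (w x)) :=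
    ⟨Nat.find hex, Nat.find_spec hex, fun j hj => Nat.find_min hex hj⟩
  refine ⟨c k, r k, hr0 k, hcx k, hcy k, hk.le, ?_⟩
  cases k with
  | zero =>
    exfalso
    have h0 : c 0 = x0 := by simp [hc]
    have h1 : r 0 = ρ := by simp [hr]
    rw [h0, h1] at hk
    exact absurd htB (not_le.2 hk)
  | succ k =>
    have h1 := not_lt.1 (hmin k (Nat.lt_succ_self k))
    rw [hvol k, ← mul_assoc, ← ENNReal.ofReal_mul ht.le, mul_comm t] at h1
    exact (lintegral_mono_set (hnest k)).trans h1

lemma rhaux_cover {n : ℕ} [Nontrivial (EuclideanSpace ℝ (Fin n))] (x0 : EuclideanSpace ℝ (Fin n)) (ρ : ℝ) (hρ : 0 < ρ)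
    (w : EuclideanSpace ℝ (Fin n) → ℝ) (hw : Measurable w)
    (hpos : ∀ᵐ x ∂volume.restrict (Metric.ball x0 ρ), 0 < w x)
    (hi : IntegrableOn w (Metric.ball x0 ρ)) (t η Kd : ℝ) (ht : 0 < t) (hKd : 0 < Kd)
    (htB : ∫⁻ x in Metric.ball x0 ρ, ENNReal.ofReal (w x) ≤
      ENNReal.ofReal t * volume (Metric.ball x0 ρ))
    (hD : ∀ c r, 0 < r → dist c x0 + r ≤ ρ →
      ∫⁻ x in Metric.ball c (6 * r) ∩ Metric.ball x0 ρ, ENNReal.ofReal (w x) ≤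
        ENNReal.ofReal Kd * ∫⁻ x in Metric.ball c r, ENNReal.ofReal (w x))
    (hL : ∀ c r, 0 < r → dist c x0 + r ≤ ρ → 
      ENNReal.ofReal t * volume (Metric.ball c r) ≤ ∫⁻ x in Metric.ball c r, ENNReal.ofReal (w x) →
      volume (Metric.ball c r ∩ {x | w x ≤ η * t}) ≤ ENNReal.ofReal (1/2) * volume (Metric.ball c r)) :
    ∫⁻ x in {x | t < w x} ∩ Metric.ball x0 ρ, ENNReal.ofReal (w x) ≤ 
      ENNReal.ofReal (Kd * 2 ^ (n + 1) * t) * volume ({x | η * t < w x} ∩ Metric.ball x0 ρ) := by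
  set ν : Measure (EuclideanSpace ℝ (Fin n)) := volume.withDensity (fun x => ENNReal.ofReal (w x)) with hν
  have hνa : ∀ S, MeasurableSet S → ∫⁻ x in S, ENNReal.ofReal (w x) = ν S := fun S hS =>
    (withDensity_apply _ hS).symm
  have hm1 : ∀ s : ℝ, MeasurableSet {x | s < w x} := fun s => measurableSet_lt measurable_const hw
  have hst := rhaux_stop x0 ρ hρ w hpos hi t ht htB
  have hstν : ∀ᵐ y ∂ν, _ := withDensity_absolutelyContinuous _ _ hst
  rw [hνa _ ((hm1 t).inter measurableSet_ball)]
  set G := {y | (y ∈ Metric.ball x0 ρ ∧ t < w y) ∧ ∃ c r, 0 < r ∧ dist c x0 + r ≤ ρ ∧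
      y ∈ Metric.ball c r ∧ 
      ENNReal.ofReal t * volume (Metric.ball c r) ≤ ∫⁻ x in Metric.ball c r, ENNReal.ofReal (w x) ∧
      ∫⁻ x in Metric.ball c r, ENNReal.ofReal (w x) ≤
        ENNReal.ofReal (2 ^ n * t) * volume (Metric.ball c r)} with hG
  have hGle : ν ({x | t < w x} ∩ Metric.ball x0 ρ) ≤ ν G := by
    apply measure_mono_ae
    filter_upwards [hstν] with y hy hy2
    exact ⟨⟨hy2.2, hy2.1⟩, hy hy2.2 hy2.1⟩
  refine hGle.trans ?_
  have hch : ∀ y : EuclideanSpace ℝ (Fin n), ∃ c r, y ∈ G → 0 < r ∧ dist c x0 + r ≤ ρ ∧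
      y ∈ Metric.ball c r ∧ 
      ENNReal.ofReal t * volume (Metric.ball c r) ≤ ∫⁻ x in Metric.ball c r, ENNReal.ofReal (w x) ∧
      ∫⁻ x in Metric.ball c r, ENNReal.ofReal (w x) ≤
        ENNReal.ofReal (2 ^ n * t) * volume (Metric.ball c r) := by
    intro y
    by_cases hy : y ∈ G
    · obtain ⟨c, r, h⟩ := hy.2
      exact ⟨c, r, fun _ => h⟩
    · exact ⟨0, 0, fun h => absurd h hy⟩
  choose c r hcr using hch
  obtain ⟨u, huG, hdisj, hcov⟩ := Vitali.exists_disjoint_subfamily_covering_enlargement_closedBall G c r ρ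
    (fun a ha => by have := hcr a ha; linarith [this.2.1, dist_nonneg (x := c a) (y := x0)]) 5 (by norm_num)
  have hdisj' : u.PairwiseDisjoint fun a => Metric.ball (c a) (r a) := 
    hdisj.mono fun a => Metric.ball_subset_closedBall
  have hcount : u.Countable := hdisj'.countable_of_isOpen (fun a _ => Metric.isOpen_ball)
    (fun a ha => ⟨c a, Metric.mem_ball_self (hcr a (huG ha)).1⟩)
  have hGsub : G ⊆ ⋃ a ∈ u, Metric.ball (c a) (6 * r a) ∩ Metric.ball x0 ρ := by
    intro y hy
    obtain ⟨b, hb, hsub⟩ := hcov y hy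
    simp only [Set.mem_iUnion]
    refine ⟨b, hb, ?_, hy.1.1⟩
    have h1 := hsub (Metric.ball_subset_closedBall (hcr y hy).2.2.1)
    have h2 := (hcr b (huG hb)).1
    exact Metric.closedBall_subset_ball (by linarith) h1
  have hK2 : ENNReal.ofReal (Kd * 2 ^ (n + 1) * t) = ENNReal.ofReal Kd * (ENNReal.ofReal (2 ^ n * t) * 2) := by
    rw [show (2:ENNReal) = ENNReal.ofReal 2 by simp, ← ENNReal.ofReal_mul (by positivity), ← ENNReal.ofReal_mul (by positivity)]
    congr 1; ring
  have hterm : ∀ a ∈ u, ν (Metric.ball (c a) (6 * r a) ∩ Metric.ball x0 ρ) ≤ 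
      ENNReal.ofReal (Kd * 2 ^ (n + 1) * t) * volume (Metric.ball (c a) (r a) ∩ {x | η * t < w x}) := by
    intro a ha
    obtain ⟨h1, h2, h3, h4, h5⟩ := hcr a (huG ha)
    rw [← hνa _ (measurableSet_ball.inter measurableSet_ball), hK2]
    refine (hD _ _ h1 h2).trans ?_
    rw [mul_assoc, mul_assoc]
    refine mul_le_mul_right (h5.trans ?_) _
    refine mul_le_mul_right ?_ _
    have h6 := hL _ _ h1 h2 h4
    set V := volume (Metric.ball (c a) (r a)) with hV
    have hVt : V ≠ ⊤ := measure_ball_lt_top.ne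
    have h7 : V ≤ volume (Metric.ball (c a) (r a) ∩ {x | η * t < w x}) + ENNReal.ofReal (1/2) * V := by
      refine le_trans (le_trans (measure_mono ?_) (measure_union_le _ _)) (add_le_add_right h6 _)
      intro x hx
      rcases lt_or_ge (η * t) (w x) with h | h
      · exact Or.inl ⟨hx, h⟩
      · exact Or.inr ⟨hx, h⟩
    have h8 : ENNReal.ofReal (1/2) * V + ENNReal.ofReal (1/2) * V = V := by
      rw [← add_mul, ← ENNReal.ofReal_add (by norm_num) (by norm_num)]; norm_num
    have h9 : ENNReal.ofReal (1/2) * V ≤ volume (Metric.ball (c a) (r a) ∩ {x | η * t < w x}) := by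
      refine ENNReal.le_of_add_le_add_right (a := ENNReal.ofReal (1/2) * V) (ENNReal.mul_ne_top ENNReal.ofReal_ne_top hVt) ?_
      rw [h8]; exact h7
    calc V = 2 * (ENNReal.ofReal (1/2) * V) := by rw [two_mul, h8]
      _ ≤ _ := by gcongr
  have : Countable u := hcount.to_subtype
  calc ν G ≤ ν (⋃ a ∈ u, Metric.ball (c a) (6 * r a) ∩ Metric.ball x0 ρ) := measure_mono hGsub
    _ ≤ ∑' a : u, ν (Metric.ball (c a) (6 * r a) ∩ Metric.ball x0 ρ) := measure_biUnion_le _ hcount _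
    _ ≤ ∑' a : u, ENNReal.ofReal (Kd * 2 ^ (n + 1) * t) * volume (Metric.ball (c a) (r a) ∩ {x | η * t < w x}) :=
        ENNReal.tsum_le_tsum fun a => hterm a a.2
    _ = ENNReal.ofReal (Kd * 2 ^ (n + 1) * t) * volume (⋃ a ∈ u, Metric.ball (c a) (r a) ∩ {x | η * t < w x}) := by
        rw [ENNReal.tsum_mul_left, measure_biUnion hcount]
        · exact hdisj'.mono fun a => Set.inter_subset_left
        · intro a _; exact measurableSet_ball.inter (hm1 _)
    _ ≤ _ := by
        refine mul_le_mul_right (measure_mono ?_) _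
        refine Set.iUnion₂_subset fun a ha x hx => ⟨hx.2, ?_⟩
        exact Metric.ball_subset_ball' (by linarith [(hcr a (huG ha)).2.1]) hx.1

lemma rhaux_pMean {n : ℕ} (w : EuclideanSpace ℝ (Fin n) → ℝ) (r : ℝ) (hr : r ≠ 0) (B) :
    pMean w (r : EReal) B = (⨍ x in B, (w x) ^ r) ^ (1 / r) := by
  simp [pMean, hr]

lemma rhaux_fin {n : ℕ} (w : EuclideanSpace ℝ (Fin n) → ℝ) (r : ℝ) (hr : r ≠ 0) (B) :
    MeanFinite w (r : EReal) B ↔ IntegrableOn (fun x => (w x) ^ r) B := by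
  simp [MeanFinite, hr]

lemma rhaux_main (n : ℕ) (hn : 1 ≤ n) (p C : ℝ) (hp : 1 < p) (hC : 1 ≤ C) :
    ∃ δ : ℝ, 0 < δ ∧ ∀ (Ω : Set (EuclideanSpace ℝ (Fin n))) (w : EuclideanSpace ℝ (Fin n) → ℝ),
      IsWeight Ω w → MemRC Ω w ((1 / (1 - p) : ℝ) : EReal) 1 C →
      MemRC Ω w 1 ((1 + δ : ℝ) : EReal) 2 := by
  have : Nonempty (Fin n) := ⟨⟨0, hn⟩⟩
  set q := 1 / (p - 1) with hq
  have hq0 : 0 < q := one_div_pos.2 (by linarith)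
  have hpq : 1 / (1 - p) = -q := by rw [hq, ← neg_sub p 1, div_neg]
  have hC0 : 0 < C := by linarith
  set θ : ℝ := (1 / 16) ^ n with hθ
  have hθ0 : 0 < θ := by positivity
  set s := (θ / 2) ^ (1 / q) / C with hs
  have hs0 : 0 < s := by positivity
  set η := ((1:ℝ) / 2) ^ (1 / q) / C with hη
  have hη0 : 0 < η := by positivity
  have hη1 : η ≤ 1 := by
    rw [hη, div_le_one hC0]
    refine le_trans (Real.rpow_le_one (by norm_num) (by norm_num) (by positivity)) hC
  have hsq : (C * s) ^ q = θ / 2 := by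
    rw [hs, mul_div_cancel₀ _ hC0.ne', ← Real.rpow_mul (by positivity), one_div_mul_cancel hq0.ne', Real.rpow_one]
  have hηq : (C * η) ^ q = 1 / 2 := by
    rw [hη, mul_div_cancel₀ _ hC0.ne', ← Real.rpow_mul (by positivity), one_div_mul_cancel hq0.ne', Real.rpow_one]
  set Kd := 2 / (s * θ) with hKd
  have hKd0 : 0 < Kd := by positivity
  set K := Kd * 2 ^ (n + 1) with hK
  have hK0 : 0 < K := by positivity
  set δ := min 1 (η ^ 2 / (2 * K)) with hδ
  have hδ0 : 0 < δ := lt_min one_pos (by positivity)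
  have hδK : δ * K * (1 / η) ^ (1 + δ) ≤ 1 / 2 := by
    have h1 : (1 / η) ^ (1 + δ) ≤ (1 / η) ^ (2:ℝ) := by
      apply Real.rpow_le_rpow_of_exponent_le
      · rw [le_div_iff₀ hη0]; linarith
      · linarith [min_le_left 1 (η ^ 2 / (2 * K))]
    rw [Real.rpow_two] at h1
    have h2 : δ ≤ η ^ 2 / (2 * K) := min_le_right _ _
    calc _ ≤ η ^ 2 / (2 * K) * K * (1 / η) ^ 2 := by gcongr
      _ = 1 / 2 := by field_simp
  refine ⟨δ, hδ0, ?_⟩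
  intro Ω w hw hRC
  have h1c : (1 : EReal) = ((1 : ℝ) : EReal) := rfl
  -- data on admissible balls
  have hdat : ∀ c r, 0 < r → Metric.ball c (2 * r) ⊆ Ω →
      (∀ᵐ x ∂volume.restrict (Metric.ball c r), 0 < w x) ∧ IntegrableOn w (Metric.ball c r) ∧
      IntegrableOn (fun x => w x ^ (-q)) (Metric.ball c r) ∧
      ⨍ x in Metric.ball c r, w x ≤ C * (⨍ x in Metric.ball c r, w x ^ (-q)) ^ (-1 / q) := by
    intro c r hr hsub
    obtain ⟨h1, h2, h3⟩ := hRC _ ⟨c, r, hr, rfl, hsub⟩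
    rw [hpq, rhaux_fin _ _ (neg_ne_zero.2 hq0.ne')] at h1
    rw [h1c, rhaux_fin _ _ one_ne_zero] at h2
    rw [hpq, h1c, rhaux_pMean _ _ (neg_ne_zero.2 hq0.ne'), rhaux_pMean _ _ one_ne_zero] at h3
    simp only [Real.rpow_one, div_one] at h2 h3
    refine ⟨?_, h2, h1, ?_⟩
    · have := hw.2
      rw [ae_restrict_iff' measurableSet_ball]
      filter_upwards [this] with x hx hxb
      exact hx (hsub (Metric.ball_subset_ball (by linarith) hxb))
    · rwa [show (1 / -q) = -1 / q by rw [div_neg, neg_div]] at h3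
  have hlev : ∀ c r, 0 < r → Metric.ball c (2 * r) ⊆ Ω → ∀ s t : ℝ, 0 < s → 0 < t →
      ENNReal.ofReal t * volume (Metric.ball c r) ≤ ∫⁻ x in Metric.ball c r, ENNReal.ofReal (w x) →
      volume (Metric.ball c r ∩ {x | w x ≤ s * t}) ≤ ENNReal.ofReal ((C * s) ^ q) * volume (Metric.ball c r) := by
    intro c r hr hsub s t hs ht hta
    obtain ⟨h1, h2, h3, h4⟩ := hdat c r hr hsub
    have : IsFiniteMeasure (volume.restrict (Metric.ball c r)) := ⟨by simpa using measure_ball_lt_top⟩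
    have := rhaux_level (volume.restrict (Metric.ball c r))
      (by simpa using (Metric.measure_ball_pos volume c hr).ne') w q C hq0 hC h1 h2 h3 h4 s t hs ht (by simpa using hta)
    rw [Measure.restrict_apply (measurableSet_le hw.1 measurable_const), Measure.restrict_apply_univ, Set.inter_comm] at this
    exact this
  have hfin : ∀ c r, 0 < r → Metric.ball c (2 * r) ⊆ Ω →
      ∫⁻ x in Metric.ball c r, ENNReal.ofReal (w x) ≠ ⊤ := by
    intro c r hr hsub
    obtain ⟨h1, h2, h3, h4⟩ := hdat c r hr hsub
    rw [← ofReal_integral_eq_lintegral_ofReal h2 (h1.mono fun x hx => hx.le)]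
    exact ENNReal.ofReal_ne_top
  have hdoub : ∀ c r c' r', 0 < r → Metric.ball c (2 * r) ⊆ Ω → 0 < r' → 
      Metric.ball c' r' ⊆ Metric.ball c r → r ≤ 16 * r' → 
      ∫⁻ x in Metric.ball c r, ENNReal.ofReal (w x) ≤ 
        ENNReal.ofReal Kd * ∫⁻ x in Metric.ball c' r', ENNReal.ofReal (w x) := by
    intro c r c' r' hr hsub hr' hss hrr
    refine rhaux_doubling volume w hw.1 _ _ measurableSet_ball measurableSet_ball hss
      (Metric.measure_ball_pos volume c hr).ne' measure_ball_lt_top.ne θ s hθ0 hs0 (hfin c r hr hsub) ?_ ?_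
    · intro t ht hta
      rw [← hsq]
      exact hlev c r hr hsub s t hs0 ht hta
    · rw [Measure.addHaar_ball_of_pos _ _ hr, Measure.addHaar_ball_of_pos _ _ hr', ← mul_assoc,
        ← ENNReal.ofReal_mul (by positivity), finrank_euclideanSpace_fin, hθ, ← mul_pow]
      gcongr
      linarith
  rintro B ⟨x0, ρ, hρ, rfl, hsubΩ⟩
  obtain ⟨hpos, hi, -, -⟩ := hdat x0 ρ hρ hsubΩ
  have hadm : ∀ c r, dist c x0 + r ≤ 2 * ρ → Metric.ball c r ⊆ Ω := fun c r h =>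
    (Metric.ball_subset_ball' (by linarith)).trans hsubΩ
  have hadm2 : ∀ c r, 0 < r → dist c x0 + r ≤ ρ → Metric.ball c (2 * r) ⊆ Ω := fun c r hr h =>
    hadm c (2 * r) (by linarith [dist_nonneg (x := c) (y := x0)])
  set μ := volume.restrict (Metric.ball x0 ρ) with hμ
  have hμf : IsFiniteMeasure μ := ⟨by simpa [hμ] using measure_ball_lt_top⟩
  have hμu : μ Set.univ = volume (Metric.ball x0 ρ) := by simp [hμ]
  have hV : 0 < μ.real Set.univ := ENNReal.toReal_pos
    (by rw [hμu]; exact (Metric.measure_ball_pos _ _ hρ).ne') (measure_ne_top _ _)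
  set l := ⨍ x, w x ∂μ with hl
  have hw0 : 0 ≤ᵐ[μ] w := hpos.mono fun x hx => hx.le
  have hli : ∫ x, w x ∂μ = l * μ.real Set.univ := by
    rw [hl, average_eq, smul_eq_mul]; field_simp
  have hl0 : 0 ≤ l := by
    have : 0 ≤ l * μ.real Set.univ := hli ▸ integral_nonneg_of_ae hw0
    exact nonneg_of_mul_nonneg_left this hV
  have hVeq : μ Set.univ = ENNReal.ofReal (μ.real Set.univ) := by simp
  have hlint : ∫⁻ x, ENNReal.ofReal (w x) ∂μ = ENNReal.ofReal (l * μ.real Set.univ) := by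
    rw [← hli, ofReal_integral_eq_lintegral_ofReal hi hw0]
  have hfinal := rhaux_layer μ w hw.1 hw0 (hfin x0 ρ hρ hsubΩ) K η l δ hK0 hη0 hη1 hl0 hδ0 hδK (by
    intro t hlt ht
    have := rhaux_cover x0 ρ hρ w hw.1 hpos hi t η Kd ht hKd0 (by
        rw [← hμ, hlint, ← hμu, hVeq, ← ENNReal.ofReal_mul ht.le]
        gcongr) (by
        intro c r hr hcr
        rcases le_or_gt (11 * r) ρ with h11 | h11
        · refine (lintegral_mono_set Set.inter_subset_left).trans ?_
          exact hdoub c (6 * r) c r (by linarith) (hadm _ _ (by linarith)) hr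
            (Metric.ball_subset_ball (by linarith)) (by linarith)
        · refine (lintegral_mono_set Set.inter_subset_right).trans ?_
          exact hdoub x0 ρ c r hρ hsubΩ hr (Metric.ball_subset_ball' (by linarith)) (by linarith)) (by
        intro c r hr hcr hta
        rw [← hηq]
        exact hlev c r hr (hadm2 c r hr hcr) η t hη0 ht hta)
    rw [hμ, Measure.restrict_restrict (measurableSet_lt measurable_const hw.1),
      Measure.restrict_apply (measurableSet_lt measurable_const hw.1)]
    exact this)
  have hpow0 : 0 ≤ᵐ[μ] fun x => w x ^ (1 + δ) := hpos.mono fun x hx => (Real.rpow_pos_of_pos hx _).le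
  have hm : AEStronglyMeasurable (fun x => w x ^ (1 + δ)) μ := (hw.1.pow_const _).aestronglyMeasurable
  have h2mul : ∀ a : ℝ, 2 * ENNReal.ofReal a = ENNReal.ofReal (2 * a) := fun a => by
    rw [ENNReal.ofReal_mul (by norm_num)]; simp
  rw [hlint, ← ENNReal.ofReal_mul (by positivity), h2mul] at hfinal
  have hint : Integrable (fun x => w x ^ (1 + δ)) μ := by
    refine ⟨hm, ?_⟩
    rw [hasFiniteIntegral_iff_ofReal hpow0]
    exact hfinal.trans_lt ENNReal.ofReal_lt_top
  rw [← ofReal_integral_eq_lintegral_ofReal hint hpow0, ENNReal.ofReal_le_ofReal_iff (by positivity)] at hfinal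
  have h1δ : (1 + δ) ≠ 0 := by positivity
  rw [h1c, rhaux_fin _ _ one_ne_zero, rhaux_fin _ _ h1δ, rhaux_pMean _ _ one_ne_zero, rhaux_pMean _ _ h1δ]
  simp only [Real.rpow_one, div_one]
  refine ⟨hi, hint, ?_⟩
  change (⨍ x, w x ^ (1 + δ) ∂μ) ^ (1 / (1 + δ)) ≤ 2 * l
  have hav : ⨍ x, w x ^ (1 + δ) ∂μ ≤ (2 * l) ^ (1 + δ) := by
    rw [average_eq, smul_eq_mul, ← div_eq_inv_mul, div_le_iff₀ hV]
    refine hfinal.trans ?_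
    have h2 : (2:ℝ) ≤ 2 ^ (1 + δ) := by
      calc (2:ℝ) = 2 ^ (1:ℝ) := by simp
        _ ≤ _ := Real.rpow_le_rpow_of_exponent_le (by norm_num) (by linarith)
    rw [Real.mul_rpow (by norm_num) hl0]
    have h3 : l ^ (1 + δ) = l * l ^ δ := by
      rw [Real.rpow_add_of_nonneg hl0 (by norm_num) hδ0.le, Real.rpow_one]
    calc 2 * (l ^ δ * (l * μ.real Set.univ)) = 2 * l ^ (1 + δ) * μ.real Set.univ := by rw [h3]; ring
      _ ≤ _ := by gcongr
  have hav0 : 0 ≤ ⨍ x, w x ^ (1 + δ) ∂μ := by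
    rw [average_eq, smul_eq_mul]
    exact mul_nonneg (by positivity) (integral_nonneg_of_ae hpow0)
  calc _ ≤ ((2 * l) ^ (1 + δ)) ^ (1 / (1 + δ)) := Real.rpow_le_rpow hav0 hav (by positivity)
    _ = 2 * l := by
      rw [← Real.rpow_mul (by positivity), mul_one_div_cancel h1δ, Real.rpow_one]

/-- **Theorem 5.2(i).** For every `w ∈ A_p` (`1 < p < ∞`) there exists `δ > 0`, depending only
on the dimension `n`, on `p`, and on `[w]_{A_p}`, such that `w ∈ RH_{1+δ}`. -/
theorem ap_selfimproves_to_rh :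
    ∃ δ : ℕ → ℝ → ℝ → ℝ,
      ∀ (n : ℕ), 1 ≤ n → ∀ (Ω : Set (EuclideanSpace ℝ (Fin n))), IsOpen Ω →
      ∀ (p : ℝ), 1 < p → ∀ w : EuclideanSpace ℝ (Fin n) → ℝ, IsWeight Ω w →
      InRC Ω w ((1 / (1 - p) : ℝ) : EReal) 1 →
      0 < δ n p (RCconst Ω w ((1 / (1 - p) : ℝ) : EReal) 1) ∧
      InRC Ω w 1 (((1 + δ n p (RCconst Ω w ((1 / (1 - p) : ℝ) : EReal) 1) : ℝ)) : EReal) := by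
  classical
  refine ⟨fun n p c => if h : 1 ≤ n ∧ 1 < p ∧ 1 ≤ c + 1 then
    (rhaux_main n h.1 p (c + 1) h.2.1 h.2.2).choose else 1, ?_⟩
  intro n hn Ω _ p hp w hw hRC
  set c := RCconst Ω w ((1 / (1 - p) : ℝ) : EReal) 1 with hc
  obtain ⟨C0, hC0⟩ := hRC
  have hne : {C : ℝ | 1 ≤ C ∧ MemRC Ω w ((1 / (1 - p) : ℝ) : EReal) 1 C}.Nonempty := ⟨C0, hC0⟩
  have hc1 : 1 ≤ c := le_csInf hne fun C hC => hC.1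
  have h : 1 ≤ n ∧ 1 < p ∧ 1 ≤ c + 1 := ⟨hn, hp, by linarith⟩
  simp only [dif_pos h]
  obtain ⟨hpos, hmain⟩ := (rhaux_main n h.1 p (c + 1) h.2.1 h.2.2).choose_spec
  refine ⟨hpos, 2, by norm_num, hmain Ω w hw ?_⟩
  obtain ⟨C1, hC1, hlt⟩ := exists_lt_of_csInf_lt hne (show c < c + 1 by linarith)
  intro B hB
  obtain ⟨h1, h2, h3⟩ := hC1.2 B hB
  refine ⟨h1, h2, h3.trans ?_⟩
  refine mul_le_mul_of_nonneg_right hlt.le ?_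
  have hr : 1 / (1 - p) ≠ 0 := one_div_ne_zero (by linarith)
  rw [rhaux_pMean _ _ hr]
  refine Real.rpow_nonneg ?_ _
  obtain ⟨x, ρ, hρ, rfl, hsub⟩ := hB
  rw [average_eq, smul_eq_mul]
  refine mul_nonneg (by positivity) (integral_nonneg_of_ae ?_)
  refine (ae_restrict_iff' measurableSet_ball).2 ?_
  filter_upwards [hw.2] with y hy hyb
  exact Real.rpow_nonneg (hy (hsub (Metric.ball_subset_ball (by linarith) hyb))).le _
end

section
/- (Theorem 5.2(iii).) Fix 1 < s < ∞. For every weight w ∈ RH_s there exists 1 < q < ∞, depending only on the dimension n, on s, and on [w]_{RH_s}, such that w ∈ A_q. -/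
open MeasureTheory

/-- per-ball estimate -/
lemma rh_level {X : Type*} [MeasurableSpace X] (μ : Measure X) [IsFiniteMeasure μ] (w : X → ℝ)
    (hw : Measurable w) (h0 : ∀ᵐ x ∂μ, 0 < w x) (s C κ m : ℝ) (hs : 1 < s) (hC : 0 < C)
    (hκ : 0 < κ) (hκ1 : κ < 1) (hκC : κ ^ (s-1) * C ^ s ≤ 1/4) (hm : 0 < m)
    (hi : Integrable w μ) (his : Integrable (fun x => w x ^ s) μ)
    (hmean : ∫ x, w x ∂μ = m * μ.real Set.univ)
    (hrh : ∫ x, w x ^ s ∂μ ≤ C ^ s * m ^ s * μ.real Set.univ) :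
    κ / 4 * μ.real Set.univ ≤ μ.real {x | m/2 < w x ∧ w x ≤ m/κ} := by
  set H := {x | m/2 < w x ∧ w x ≤ m/κ} with hH
  have hHm : MeasurableSet H :=
    (measurableSet_lt measurable_const hw).inter (measurableSet_le hw measurable_const)
  have hpt : ∀ᵐ x ∂μ, w x ≤ m/2 + H.indicator (fun _ => m/κ) x + (κ/m)^(s-1) * w x ^ s := by
    filter_upwards [h0] with x hx
    have h1 : 0 ≤ (κ/m)^(s-1) * w x ^ s := by positivity
    have h2 : 0 ≤ H.indicator (fun _ => m/κ) x := Set.indicator_nonneg (fun _ _ => by positivity) x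
    by_cases ha : w x ≤ m/2
    · linarith
    · by_cases hb : w x ≤ m/κ
      · have : x ∈ H := ⟨not_le.1 ha, hb⟩
        rw [Set.indicator_of_mem this]
        linarith
      · have h3 : 1 ≤ κ / m * w x := by
          rw [not_le, div_lt_iff₀ hκ] at hb
          rw [div_mul_eq_mul_div, le_div_iff₀ hm]; linarith
        have h4 : (κ/m)^(s-1) * w x ^ s = (κ/m * w x)^(s-1) * w x := by
          rw [Real.mul_rpow (by positivity) hx.le, mul_assoc, ← Real.rpow_add_one hx.ne']
          simp
        have h5 : 1 ≤ (κ/m * w x)^(s-1) := Real.one_le_rpow h3 (by linarith)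
        rw [h4]; nlinarith
  have hii : Integrable (H.indicator (fun _ => m/κ)) μ := (integrable_const _).indicator hHm
  have hint := integral_mono_ae hi (((integrable_const (m/2)).add hii).add (his.const_mul ((κ/m)^(s-1)))) hpt
  rw [integral_add' ((integrable_const (m/2)).add hii) (his.const_mul ((κ/m)^(s-1))),
    integral_add' (integrable_const (m/2)) hii, integral_const_mul, integral_indicator hHm,
    integral_const, integral_const, hmean] at hint
  simp only [smul_eq_mul, measureReal_restrict_apply_univ] at hint
  have hk : (κ/m)^(s-1) * ∫ x, w x ^ s ∂μ ≤ m * μ.real Set.univ / 4 := by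
    calc _ ≤ (κ/m)^(s-1) * (C ^ s * m ^ s * μ.real Set.univ) := by gcongr
      _ = (κ ^ (s-1) * C ^ s) * m * μ.real Set.univ := by
        rw [Real.div_rpow hκ.le hm.le, Real.rpow_sub_one hm.ne']; 
        have : m ^ s ≠ 0 := by positivity
        field_simp
      _ ≤ (1/4) * m * μ.real Set.univ := by gcongr
      _ = _ := by ring
  have : m * (μ.real Set.univ) / 4 ≤ μ.real H * (m/κ) := by linarith
  have h6 : μ.real H * (m/κ) * (κ/m) = μ.real H := by field_simp
  have h7 : m * (μ.real Set.univ) / 4 * (κ/m) = κ/4 * μ.real Set.univ := by field_simp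
  rw [← h6, ← h7]
  gcongr

open ENNReal in
lemma decay_sum {X : Type*} [MeasurableSpace X] (μ : Measure X) (w : X → ℝ)
    (hw : Measurable w) (h0 : ∀ᵐ x ∂μ, 0 < w x) (a l δ : ℝ) (θ : ℝ≥0∞) (ha : 0 < a)
    (hl : 0 < l) (hl1 : l < 1) (hδ : 0 < δ)
    (h : ∀ t, 0 < t → t ≤ a → μ {x | w x ≤ l * t} ≤ θ * μ {x | w x ≤ t}) :
    ∫⁻ x, ENNReal.ofReal (w x ^ (-δ)) ∂μ ≤ ENNReal.ofReal (a ^ (-δ)) * μ Set.univ *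
      (1 + ENNReal.ofReal (l ^ (-δ)) * (1 - ENNReal.ofReal (l ^ (-δ)) * θ)⁻¹) := by
  have hk : ∀ k : ℕ, μ {x | w x ≤ l ^ k * a} ≤ θ ^ k * μ Set.univ := by
    intro k
    induction k with
    | zero => simpa using measure_mono (Set.subset_univ _)
    | succ k ih =>
      have := h (l^k*a) (by positivity) (mul_le_of_le_one_left ha.le (pow_le_one₀ hl.le hl1.le))
      rw [← mul_assoc, ← pow_succ'] at this
      refine this.trans ?_
      rw [pow_succ', mul_assoc]
      gcongr
  have hpt : ∀ᵐ x ∂μ, ENNReal.ofReal (w x ^ (-δ)) ≤ ENNReal.ofReal (a ^ (-δ)) +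
      ∑' k : ℕ, {x | w x ≤ l ^ k * a}.indicator (fun _ => ENNReal.ofReal ((l ^ (k+1) * a) ^ (-δ))) x := by
    filter_upwards [h0] with x hx
    by_cases hxa : a ≤ w x
    · refine le_add_right (ENNReal.ofReal_le_ofReal ?_)
      exact Real.rpow_le_rpow_of_nonpos ha hxa (by linarith)
    · obtain ⟨k, h1, h2⟩ := exists_nat_pow_near_of_lt_one (x := w x / a) (y := l) (by positivity)
        ((div_le_one ha).2 (not_le.1 hxa).le) hl hl1
      refine le_add_left ?_
      have hm : x ∈ {x | w x ≤ l ^ k * a} := (div_le_iff₀ ha).1 h2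
      refine le_trans ?_ (ENNReal.le_tsum k)
      rw [Set.indicator_of_mem hm]
      refine ENNReal.ofReal_le_ofReal ?_
      exact Real.rpow_le_rpow_of_nonpos (by positivity) ((lt_div_iff₀ ha).1 h1).le (by linarith)
  have hmeas : ∀ t, MeasurableSet {x | w x ≤ t} := fun t => measurableSet_le hw measurable_const
  calc _ ≤ _ := lintegral_mono_ae hpt
    _ = ENNReal.ofReal (a ^ (-δ)) * μ Set.univ + 
       ∑' k : ℕ, ENNReal.ofReal ((l ^ (k+1) * a) ^ (-δ)) * μ {x | w x ≤ l ^ k * a} := by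
      rw [lintegral_add_left measurable_const, lintegral_const, lintegral_tsum]
      · simp_rw [lintegral_indicator_const (hmeas _)]
      · intro k; exact (measurable_const.indicator (hmeas _)).aemeasurable
    _ ≤ ENNReal.ofReal (a ^ (-δ)) * μ Set.univ + 
       ∑' k : ℕ, ENNReal.ofReal (a ^ (-δ)) * μ Set.univ * ENNReal.ofReal (l ^ (-δ)) * (ENNReal.ofReal (l ^ (-δ)) * θ)^k := by
      refine add_le_add le_rfl (ENNReal.tsum_le_tsum fun k => ?_)
      have : (l ^ (k+1) * a) ^ (-δ) = a ^ (-δ) * l ^ (-δ) * (l ^ (-δ)) ^ k := by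
        rw [Real.mul_rpow (by positivity) ha.le, ← Real.rpow_natCast l, ← Real.rpow_mul hl.le, mul_comm _ (-δ), Real.rpow_mul hl.le, Real.rpow_natCast]
        ring
      rw [this, ENNReal.ofReal_mul (by positivity), ENNReal.ofReal_mul (by positivity), ENNReal.ofReal_pow (by positivity)]
      calc _ ≤ _ := mul_le_mul_right (hk k) _
        _ = _ := by rw [mul_pow]; ring
    _ = _ := by
      rw [ENNReal.tsum_mul_left, ENNReal.tsum_geometric]; ring

open Metric Filter Topology

lemma cb_ae {n : ℕ} (hn : 1 ≤ n) (c : EuclideanSpace ℝ (Fin n)) (r : ℝ) :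
    closedBall c r =ᵐ[volume] ball c r := by
  have : Nonempty (Fin n) := ⟨⟨0, hn⟩⟩
  refine (ae_eq_of_subset_of_measure_ge ball_subset_closedBall ?_ measurableSet_ball.nullMeasurableSet
    measure_closedBall_lt_top.ne).symm
  rw [Measure.addHaar_closedBall_eq_addHaar_ball]

lemma good_ball {n : ℕ} (hn : 1 ≤ n) (x0 : EuclideanSpace ℝ (Fin n)) (ρ : ℝ) (hρ : 0 < ρ)
    (w : EuclideanSpace ℝ (Fin n) → ℝ) (hi : IntegrableOn w (ball x0 ρ)) (m : ℝ)
    (hm : m < ⨍ y in ball x0 ρ, w y) :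
    ∀ᵐ x : EuclideanSpace ℝ (Fin n), x ∈ ball x0 ρ → w x < m → ∃ c r, 0 < r ∧ r ≤ ρ ∧
      r + dist c x0 ≤ ρ ∧ x ∈ closedBall c r ∧ ⨍ y in ball c r, w y = m := by
  have : Nonempty (Fin n) := ⟨⟨0, hn⟩⟩
  set f := (ball x0 ρ).indicator w with hf
  have hfi : Integrable f := (integrable_indicator_iff measurableSet_ball).2 hi
  filter_upwards [IsUnifLocDoublingMeasure.ae_tendsto_average volume hfi.locallyIntegrable 1] with x hx hxB hxm
  set c : ℝ → EuclideanSpace ℝ (Fin n) := fun r => x + (r/ρ) • (x0 - x) with hc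
  have hcc : Continuous c := by fun_prop
  have hd : ‖x0 - x‖ < ρ := by rw [← dist_eq_norm, dist_comm]; exact hxB
  have hxc : ∀ r, 0 < r → x ∈ closedBall (c r) r := by
    intro r hr
    rw [mem_closedBall, dist_eq_norm]
    have : x - c r = -((r/ρ) • (x0 - x)) := by simp [hc]
    rw [this, norm_neg, norm_smul, Real.norm_of_nonneg (by positivity)]
    calc r/ρ * ‖x0 - x‖ ≤ r/ρ * ρ := by gcongr
      _ = r := by field_simp
  have hsub' : ∀ r, 0 < r → r ≤ ρ → r + dist (c r) x0 ≤ ρ := by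
    intro r hr hrρ
    rw [dist_eq_norm]
    have : c r - x0 = -((1 - r/ρ) • (x0 - x)) := by simp [hc, sub_smul]; abel
    have h1 : r/ρ ≤ 1 := (div_le_one hρ).2 hrρ
    rw [this, norm_neg, norm_smul, Real.norm_of_nonneg (by linarith)]
    calc r + (1 - r/ρ) * ‖x0 - x‖ ≤ r + (1 - r/ρ) * ρ := by gcongr
      _ = ρ := by field_simp; ring
  have hsub : ∀ r, 0 < r → r ≤ ρ → ball (c r) r ⊆ ball x0 ρ :=
    fun r hr hrρ => ball_subset_ball' (hsub' r hr hrρ)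
  set g : ℝ → ℝ := fun r => ⨍ y in closedBall (c r) r, f y with hg
  have hgb : ∀ r, 0 < r → r ≤ ρ → g r = ⨍ y in ball (c r) r, w y := by
    intro r hr hrρ
    rw [hg]
    simp only
    rw [setAverage_congr (cb_ae hn _ _)]
    refine setAverage_congr_fun measurableSet_ball (Eventually.of_forall fun y hy => ?_)
    exact Set.indicator_of_mem (hsub r hr hrρ hy) _
  have hgc : ∀ r, 0 < r → ContinuousAt g r := by
    intro r hr
    have e1 : ∀ r, g r = (volume.real (closedBall (c r) r))⁻¹ * ∫ y, (closedBall (c r) r).indicator f y := by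
      intro r
      simp only [hg]
      rw [setAverage_eq, smul_eq_mul, integral_indicator measurableSet_closedBall]
    have e2 : g =ᶠ[𝓝 r] fun r => (r ^ n * volume.real (ball (0 : EuclideanSpace ℝ (Fin n)) 1))⁻¹ * ∫ y, (closedBall (c r) r).indicator f y := by
      filter_upwards [lt_mem_nhds hr] with r hr
      rw [e1, Measure.addHaar_real_closedBall _ _ hr.le, finrank_euclideanSpace_fin]
    refine ContinuousAt.congr ?_ e2.symm
    have hv : 0 < volume.real (ball (0 : EuclideanSpace ℝ (Fin n)) 1) :=
      ENNReal.toReal_pos (measure_ball_pos _ _ one_pos).ne' measure_ball_lt_top.ne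
    refine ContinuousAt.mul (ContinuousAt.inv₀ (by fun_prop) (by positivity)) ?_
    refine tendsto_integral_filter_of_dominated_convergence (fun y => ‖f y‖) ?_ ?_ hfi.norm ?_
    · exact Eventually.of_forall fun r => (hfi.indicator measurableSet_closedBall).aestronglyMeasurable
    · exact Eventually.of_forall fun r => Eventually.of_forall fun y => norm_indicator_le_norm_self _ _
    · have : ∀ᵐ y : EuclideanSpace ℝ (Fin n), y ∉ sphere (c r) r := by
        rw [ae_iff]; simp only [not_not]; exact Measure.addHaar_sphere volume (c r) r
      filter_upwards [this] with y hy
      have hcd : Continuous fun r => dist y (c r) := by fun_prop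
      refine tendsto_const_nhds.congr' ?_
      rcases lt_or_gt_of_ne (show dist y (c r) ≠ r from hy) with h | h
      · filter_upwards [hcd.continuousAt.eventually_lt continuousAt_id h] with r' hr'
        rw [Set.indicator_of_mem (show y ∈ closedBall (c r) r from h.le),
          Set.indicator_of_mem (show y ∈ closedBall (c r') r' from le_of_lt hr')]
      · filter_upwards [continuousAt_id.eventually_lt hcd.continuousAt h] with r' hr'
        rw [Set.indicator_of_notMem (show y ∉ closedBall (c r) r from not_le.2 h),
          Set.indicator_of_notMem (show y ∉ closedBall (c r') r' from not_le.2 hr')]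
  have hlim : Tendsto g (𝓝[>] 0) (𝓝 (f x)) := by
    refine hx c id tendsto_id ?_
    filter_upwards [self_mem_nhdsWithin] with r hr
    simpa using hxc r hr
  have hfx : f x = w x := Set.indicator_of_mem hxB _
  rw [hfx] at hlim
  obtain ⟨r1, hr1m, hr10, hr1ρ⟩ := ((hlim.eventually_lt_const hxm).and (Ioo_mem_nhdsGT hρ)).exists
  have hgρ : m < g ρ := by
    rw [hgb ρ hρ le_rfl]
    have : c ρ = x0 := by simp [hc, hρ.ne']
    rwa [this]
  obtain ⟨r, ⟨h1, h2⟩, h3⟩ := intermediate_value_Icc hr1ρ.le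
    (fun r hr => (hgc r (hr10.trans_le hr.1)).continuousWithinAt) ⟨hr1m.le, hgρ.le⟩
  have hr0 : 0 < r := hr10.trans_le h1
  exact ⟨c r, r, hr0, h2, hsub' r hr0 h2, hxc r hr0, by rw [← hgb r hr0 h2, h3]⟩

open ENNReal in
lemma level_decay {n : ℕ} (hn : 1 ≤ n) (x0 : EuclideanSpace ℝ (Fin n)) (ρ : ℝ) (hρ : 0 < ρ)
    (w : EuclideanSpace ℝ (Fin n) → ℝ) (hw : Measurable w) (hi : IntegrableOn w (ball x0 ρ))
    (κ : ℝ) (hκ : 0 < κ) (hκ1 : κ < 1)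
    (hball : ∀ c r, 0 < r → r + dist c x0 ≤ ρ → ∀ m, 0 < m → ⨍ y in ball c r, w y = m →
      ENNReal.ofReal (κ/4) * volume (ball c r) ≤
        volume ({x | m/2 < w x ∧ w x ≤ m/κ} ∩ ball c r))
    (t : ℝ) (ht : 0 < t) (hta : t ≤ ⨍ y in ball x0 ρ, w y) :
    volume.restrict (ball x0 ρ) {x | w x ≤ κ/2 * t} ≤
      (1 + ENNReal.ofReal (κ/4 / 5^n))⁻¹ * volume.restrict (ball x0 ρ) {x | w x ≤ t} := by
  have : Nonempty (Fin n) := ⟨⟨0, hn⟩⟩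
  have hm0 : 0 < κ * t := by positivity
  have hgood := good_ball hn x0 ρ hρ w hi (κ * t) (by nlinarith)
  set T : Set (EuclideanSpace ℝ (Fin n) × ℝ) := {p | 0 < p.2 ∧ p.2 ≤ ρ ∧ p.2 + dist p.1 x0 ≤ ρ ∧
    ⨍ y in ball p.1 p.2, w y = κ * t} with hT
  obtain ⟨u, huT, hdisj, hcov⟩ := Vitali.exists_disjoint_subfamily_covering_enlargement_closedBall
    T Prod.fst Prod.snd ρ (fun p hp => hp.2.1) 5 (by norm_num)
  have hdisj' : u.PairwiseDisjoint fun p => ball p.1 p.2 :=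
    hdisj.mono fun p => ball_subset_closedBall
  have hcount : u.Countable := hdisj'.countable_of_isOpen (fun _ _ => isOpen_ball)
    (fun p hp => nonempty_ball.2 (huT hp).1)
  set H := {x | κ * t/2 < w x ∧ w x ≤ t} with hH
  have hHm : MeasurableSet H :=
    (measurableSet_lt measurable_const hw).inter (measurableSet_le hw measurable_const)
  have hAm : ∀ t, MeasurableSet {x | w x ≤ t} := fun t => measurableSet_le hw measurable_const
  rw [Measure.restrict_apply (hAm _), Measure.restrict_apply (hAm _)]
  have h1 : volume ({x | w x ≤ κ/2 * t} ∩ ball x0 ρ) ≤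
      ENNReal.ofReal (5^n) * ∑' p : u, volume (ball p.1.1 p.1.2) := by
    calc _ ≤ volume (⋃ p ∈ u, closedBall p.1 (5 * p.2)) := by
          refine measure_mono_ae ?_
          filter_upwards [hgood] with x hx hxS
          obtain ⟨hxw, hxB⟩ := hxS
          obtain ⟨c, r, hr, hrρ, hs, hxc, ha⟩ := hx hxB (by
            have : w x ≤ κ/2 * t := hxw
            linarith)
          obtain ⟨b, hb, hbs⟩ := hcov (c, r) ⟨hr, hrρ, hs, ha⟩
          exact Set.mem_biUnion hb (hbs hxc)
      _ ≤ ∑' p : u, volume (closedBall p.1.1 (5 * p.1.2)) := measure_biUnion_le _ hcount _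
      _ = ∑' p : u, ENNReal.ofReal (5^n) * volume (ball p.1.1 p.1.2) := by
          refine tsum_congr fun p => ?_
          have hp := (huT p.2).1
          rw [Measure.addHaar_closedBall_mul _ _ (by norm_num) hp.le, finrank_euclideanSpace_fin,
            Measure.addHaar_closedBall_eq_addHaar_ball, Measure.addHaar_ball_center volume p.1.1]
      _ = _ := ENNReal.tsum_mul_left
  have h2 : ENNReal.ofReal (κ/4) * ∑' p : u, volume (ball p.1.1 p.1.2) ≤ volume (H ∩ ball x0 ρ) := by
    rw [← ENNReal.tsum_mul_left]
    calc _ ≤ ∑' p : u, volume (H ∩ ball p.1.1 p.1.2) := by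
          refine ENNReal.tsum_le_tsum fun p => ?_
          obtain ⟨hp, -, hs, ha⟩ := huT p.2
          have := hball _ _ hp hs _ hm0 ha
          rwa [mul_div_cancel_left₀ _ hκ.ne'] at this
      _ = volume (⋃ p ∈ u, H ∩ ball p.1 p.2) := by
          rw [measure_biUnion hcount (hdisj'.mono fun p => Set.inter_subset_right)
            (fun p _ => hHm.inter measurableSet_ball)]
      _ ≤ _ := measure_mono (Set.iUnion₂_subset fun p hp =>
          Set.inter_subset_inter_right _ (ball_subset_ball' (huT hp).2.2.1))
  have h3 : volume ({x | w x ≤ κ/2 * t} ∩ ball x0 ρ) + volume (H ∩ ball x0 ρ) ≤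
      volume ({x | w x ≤ t} ∩ ball x0 ρ) := by
    rw [← measure_union _ (hHm.inter measurableSet_ball)]
    · refine measure_mono (Set.union_subset ?_ ?_)
      · rintro x ⟨hx, hxB⟩
        have : w x ≤ κ/2 * t := hx
        exact ⟨show w x ≤ t by nlinarith, hxB⟩
      · rintro x ⟨hx, hxB⟩
        exact ⟨hx.2, hxB⟩
    · rw [Set.disjoint_left]
      rintro x ⟨hx, -⟩ ⟨hx', -⟩
      have h4 : w x ≤ κ/2 * t := hx
      have h5 : κ * t/2 < w x := hx'.1
      linarith
  set c := ENNReal.ofReal (κ/4 / 5^n) with hcdef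
  have hc : c * ENNReal.ofReal (5^n) = ENNReal.ofReal (κ/4) := by
    rw [← ENNReal.ofReal_mul (by positivity), div_mul_cancel₀ _ (by positivity)]
  have h6 : c * volume ({x | w x ≤ κ/2 * t} ∩ ball x0 ρ) ≤ volume (H ∩ ball x0 ρ) := by
    calc _ ≤ c * (ENNReal.ofReal (5^n) * ∑' p : u, volume (ball p.1.1 p.1.2)) :=
          mul_le_mul_right h1 _
      _ = _ := by rw [← mul_assoc, hc]
      _ ≤ _ := h2
  rw [mul_comm (1 + c)⁻¹, ← div_eq_mul_inv, ENNReal.le_div_iff_mul_le (by simp) (by simp [hcdef])]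
  calc _ = volume ({x | w x ≤ κ/2 * t} ∩ ball x0 ρ) + c * volume ({x | w x ≤ κ/2 * t} ∩ ball x0 ρ) := by ring
    _ ≤ _ := (add_le_add le_rfl h6).trans h3

lemma pMean_coe {n : ℕ} (w : EuclideanSpace ℝ (Fin n) → ℝ) (p : ℝ) (hp : p ≠ 0)
    (B : Set (EuclideanSpace ℝ (Fin n))) :
    pMean w (p : EReal) B = (⨍ x in B, (w x) ^ p) ^ (1 / p) := by
  simp [pMean, hp]

lemma meanFinite_coe {n : ℕ} (w : EuclideanSpace ℝ (Fin n) → ℝ) (p : ℝ) (hp : p ≠ 0)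
    (B : Set (EuclideanSpace ℝ (Fin n))) :
    MeanFinite w (p : EReal) B ↔ IntegrableOn (fun x => (w x) ^ p) B := by
  simp [MeanFinite, hp]

lemma pMean_one {n : ℕ} (w : EuclideanSpace ℝ (Fin n) → ℝ)
    (B : Set (EuclideanSpace ℝ (Fin n))) : pMean w 1 B = ⨍ x in B, w x := by
  rw [← EReal.coe_one, pMean_coe w 1 one_ne_zero]; simp

lemma meanFinite_one {n : ℕ} (w : EuclideanSpace ℝ (Fin n) → ℝ)
    (B : Set (EuclideanSpace ℝ (Fin n))) : MeanFinite w 1 B ↔ IntegrableOn w B := by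
  rw [← EReal.coe_one, meanFinite_coe w 1 one_ne_zero]; simp

lemma avg_pos {n : ℕ} (w : EuclideanSpace ℝ (Fin n) → ℝ) (c : EuclideanSpace ℝ (Fin n)) (r : ℝ)
    (hr : 0 < r) (hi : IntegrableOn w (ball c r))
    (h0 : ∀ᵐ x ∂(volume.restrict (ball c r)), 0 < w x) : 0 < ⨍ x in ball c r, w x := by
  have hv : 0 < volume.real (ball c r) :=
    ENNReal.toReal_pos (measure_ball_pos _ _ hr).ne' measure_ball_lt_top.ne
  rw [setAverage_eq, smul_eq_mul]
  refine mul_pos (inv_pos.2 hv) ?_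
  rw [integral_pos_iff_support_of_nonneg_ae (h0.mono fun x hx => hx.le) hi]
  have : volume.restrict (ball c r) (Function.support w)ᶜ = 0 :=
    measure_mono_null (fun x hx h => hx (ne_of_gt h)) h0
  rw [pos_iff_ne_zero]
  intro h
  have h2 : volume.restrict (ball c r) Set.univ = 0 := by
    rw [← Set.union_compl_self (Function.support w)]
    exact measure_union_null h this
  rw [Measure.restrict_apply_univ] at h2
  exact (measure_ball_pos _ _ hr).ne' h2

open ENNReal in
lemma main_bound (n : ℕ) (hn : 1 ≤ n) (s : ℝ) (hs : 1 < s) (C : ℝ) (hC : 1 ≤ C) :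
    ∃ δ : ℝ, 0 < δ ∧ ∃ K : ℝ≥0∞, K ≠ ⊤ ∧ 1 ≤ K ∧
      ∀ (Ω : Set (EuclideanSpace ℝ (Fin n))) (w : EuclideanSpace ℝ (Fin n) → ℝ),
      IsWeight Ω w → MemRC Ω w 1 (s : EReal) C → ∀ x0 ρ, 0 < ρ → ball x0 (2 * ρ) ⊆ Ω →
      ∫⁻ x in ball x0 ρ, ENNReal.ofReal (w x ^ (-δ)) ≤
        ENNReal.ofReal ((⨍ x in ball x0 ρ, w x) ^ (-δ)) * volume (ball x0 ρ) * K := by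
  have hC0 : 0 < C := by linarith
  obtain ⟨κ, hκ, hκ1, hκC⟩ : ∃ κ : ℝ, 0 < κ ∧ κ < 1 ∧ κ ^ (s-1) * C ^ s ≤ 1/4 := by
    refine ⟨min (1/2) ((1 / (4 * C ^ s)) ^ (1/(s-1))), by positivity,
      (min_le_left _ _).trans_lt (by norm_num), ?_⟩
    have h1 : (min (1/2) ((1 / (4 * C ^ s)) ^ (1/(s-1)))) ^ (s-1) ≤ 1 / (4 * C ^ s) := by
      calc _ ≤ ((1 / (4 * C ^ s)) ^ (1/(s-1))) ^ (s-1) :=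
            Real.rpow_le_rpow (by positivity) (min_le_right _ _) (by linarith)
        _ = _ := by
          rw [← Real.rpow_mul (by positivity), one_div_mul_cancel (by linarith), Real.rpow_one]
    calc _ ≤ 1 / (4 * C ^ s) * C ^ s := by gcongr
      _ = 1/4 := by
        have : C ^ s ≠ 0 := by positivity
        field_simp
  set c : ℝ := κ/4 / 5^n with hc
  have hc0 : 0 < c := by positivity
  have hl0 : 0 < κ/2 := by positivity
  have hl1 : κ/2 < 1 := by linarith
  have hlog : Real.log (κ/2) < 0 := Real.log_neg hl0 hl1
  have hlog2 : 0 < Real.log (1 + c) := Real.log_pos (by linarith)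
  obtain ⟨δ, hδ, hδ1⟩ : ∃ δ : ℝ, 0 < δ ∧ (κ/2) ^ (-δ) < 1 + c := by
    refine ⟨Real.log (1+c) / 2 / (- Real.log (κ/2)), div_pos (by linarith) (by linarith), ?_⟩
    rw [Real.rpow_def_of_pos hl0]
    have : Real.log (κ/2) * -(Real.log (1+c) / 2 / (- Real.log (κ/2))) = Real.log (1+c) / 2 := by
      have := hlog.ne
      generalize Real.log (κ/2) = z at this
      field_simp
    rw [this, ← Real.lt_log_iff_exp_lt (by linarith)]
    linarith
  have hfin : ENNReal.ofReal ((κ/2) ^ (-δ)) * (1 + ENNReal.ofReal c)⁻¹ < 1 := by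
    rw [← div_eq_mul_inv]
    refine ENNReal.div_lt_of_lt_mul ?_
    rw [one_mul, ← ENNReal.ofReal_one, ← ENNReal.ofReal_add zero_le_one hc0.le]
    exact (ENNReal.ofReal_lt_ofReal_iff (by linarith)).2 hδ1
  refine ⟨δ, hδ, 1 + ENNReal.ofReal ((κ/2) ^ (-δ)) *
    (1 - ENNReal.ofReal ((κ/2) ^ (-δ)) * (1 + ENNReal.ofReal c)⁻¹)⁻¹, ?_, le_self_add, ?_⟩
  · refine ENNReal.add_ne_top.2 ⟨ENNReal.one_ne_top, ENNReal.mul_ne_top ENNReal.ofReal_ne_top ?_⟩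
    rw [ENNReal.inv_ne_top]
    exact (tsub_pos_of_lt hfin).ne'
  intro Ω w ⟨hw, hpos⟩ hRC x0 ρ hρ hΩ
  have hBΩ : ball x0 ρ ⊆ Ω := (ball_subset_ball (by linarith)).trans hΩ
  have hposB : ∀ c r, ball c r ⊆ ball x0 ρ → ∀ᵐ x ∂(volume.restrict (ball c r)), 0 < w x := by
    intro c r h
    rw [ae_restrict_iff' measurableSet_ball]
    filter_upwards [hpos] with x hx hxB
    exact hx (hBΩ (h hxB))
  have hint : IntegrableOn w (ball x0 ρ) :=
    (meanFinite_one _ _).1 (hRC _ ⟨x0, ρ, hρ, rfl, hΩ⟩).1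
  have ha := avg_pos w x0 ρ hρ hint (hposB _ _ le_rfl)
  have hball : ∀ c r, 0 < r → r + dist c x0 ≤ ρ → ∀ m, 0 < m → ⨍ y in ball c r, w y = m →
      ENNReal.ofReal (κ/4) * volume (ball c r) ≤
        volume ({x | m/2 < w x ∧ w x ≤ m/κ} ∩ ball c r) := by
    intro c r hr hdist m hm hmean
    have hsub : ball c r ⊆ ball x0 ρ := ball_subset_ball' hdist
    have hadm : ball c r ∈ ballsIn Ω := by
      refine ⟨c, r, hr, rfl, subset_trans ?_ hΩ⟩
      refine ball_subset_ball' ?_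
      have : 0 ≤ dist c x0 := dist_nonneg
      linarith
    obtain ⟨h1, h2, h3⟩ := hRC _ hadm
    rw [meanFinite_one] at h1
    rw [meanFinite_coe _ _ (by linarith)] at h2
    rw [pMean_one, pMean_coe _ _ (by linarith), hmean] at h3
    have hv : 0 < volume.real (ball c r) :=
      ENNReal.toReal_pos (measure_ball_pos _ _ hr).ne' measure_ball_lt_top.ne
    have hfm : IsFiniteMeasure (volume.restrict (ball c r)) :=
      ⟨by rw [Measure.restrict_apply_univ]; exact measure_ball_lt_top⟩
    have hp := hposB c r hsub
    have hav0 : 0 ≤ ⨍ x in ball c r, w x ^ s := by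
      rw [setAverage_eq]
      refine smul_nonneg (by positivity) (integral_nonneg_of_ae (hp.mono fun x hx => ?_))
      exact Real.rpow_nonneg hx.le _
    have h4 : ⨍ x in ball c r, w x ^ s ≤ C ^ s * m ^ s := by
      rw [← Real.mul_rpow hC0.le hm.le]
      have := Real.rpow_le_rpow (Real.rpow_nonneg hav0 _) h3 (by linarith : 0 ≤ s)
      rwa [← Real.rpow_mul hav0, one_div_mul_cancel (by linarith), Real.rpow_one] at this
    rw [setAverage_eq, smul_eq_mul] at h4 hmean
    rw [inv_mul_le_iff₀ hv] at h4
    rw [inv_mul_eq_iff_eq_mul₀ hv.ne'] at hmean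
    have key := rh_level (volume.restrict (ball c r)) w hw hp s C κ m hs hC0 hκ hκ1 hκC hm h1 h2
      (by rw [measureReal_restrict_apply_univ, hmean]; ring)
      (by rw [measureReal_restrict_apply_univ]; linarith)
    have hHm : MeasurableSet {x | m/2 < w x ∧ w x ≤ m/κ} :=
      (measurableSet_lt measurable_const hw).inter (measurableSet_le hw measurable_const)
    rw [measureReal_restrict_apply_univ, measureReal_restrict_apply hHm] at key
    have key2 := ENNReal.ofReal_le_ofReal key
    rw [ENNReal.ofReal_mul (by positivity), ofReal_measureReal measure_ball_lt_top.ne,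
      ofReal_measureReal (measure_ne_top_of_subset Set.inter_subset_right measure_ball_lt_top.ne)] at key2
    exact key2
  have := decay_sum (volume.restrict (ball x0 ρ)) w hw (hposB _ _ le_rfl) _ (κ/2) δ
    (1 + ENNReal.ofReal c)⁻¹ ha hl0 hl1 hδ
    (level_decay hn x0 ρ hρ w hw hint κ hκ hκ1 hball)
  rwa [Measure.restrict_apply_univ] at this

/-- **Theorem 5.2(iii).** For every `w ∈ RH_s` (`1 < s < ∞`) there exists `1 < q < ∞`,
depending only on the dimension `n`, on `s`, and on `[w]_{RH_s}`, such that `w ∈ A_q`. -/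
theorem rhs_implies_aq :
    ∃ q : ℕ → ℝ → ℝ → ℝ,
      ∀ (n : ℕ), 1 ≤ n → ∀ (Ω : Set (EuclideanSpace ℝ (Fin n))), IsOpen Ω →
      ∀ (s : ℝ), 1 < s → ∀ w : EuclideanSpace ℝ (Fin n) → ℝ, IsWeight Ω w →
      InRC Ω w 1 ((s : ℝ) : EReal) →
      1 < q n s (RCconst Ω w 1 ((s : ℝ) : EReal)) ∧
      InRC Ω w ((1 / (1 - q n s (RCconst Ω w 1 ((s : ℝ) : EReal))) : ℝ) : EReal) 1 := by
  have key : ∀ (n : ℕ) (s c : ℝ), ∃ q : ℝ, 1 ≤ n → 1 < s → 1 ≤ c → 1 < q ∧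
      ∀ (Ω : Set (EuclideanSpace ℝ (Fin n))) (w : EuclideanSpace ℝ (Fin n) → ℝ),
      IsWeight Ω w → MemRC Ω w 1 (s : EReal) (c + 1) →
      InRC Ω w ((1 / (1 - q) : ℝ) : EReal) 1 := by
    intro n s c
    by_cases h : 1 ≤ n ∧ 1 < s ∧ 1 ≤ c
    swap
    · exact ⟨0, fun h1 h2 h3 => absurd ⟨h1, h2, h3⟩ h⟩
    obtain ⟨hn, hs, hc⟩ := h
    obtain ⟨δ, hδ, K, hK, hK1, hmain⟩ := main_bound n hn s hs (c + 1) (by linarith)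
    refine ⟨1 + 1/δ, fun _ _ _ => ⟨by have : 0 < 1/δ := by positivity
                                      linarith, ?_⟩⟩
    intro Ω w hw hRC
    have hq : 1 / (1 - (1 + 1/δ)) = -δ := by field_simp; ring
    rw [hq]
    have hK1' : 1 ≤ K.toReal := by
      rw [← ENNReal.toReal_one]; exact ENNReal.toReal_mono hK hK1
    refine ⟨K.toReal ^ (1/δ), Real.one_le_rpow hK1' (by positivity), ?_⟩
    rintro B ⟨x0, ρ, hρ, rfl, hΩ⟩
    have hb := hmain Ω w hw hRC x0 ρ hρ hΩ
    have hint := (meanFinite_one _ _).1 (hRC _ ⟨x0, ρ, hρ, rfl, hΩ⟩).1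
    have hpos : ∀ᵐ x ∂(volume.restrict (ball x0 ρ)), 0 < w x := by
      rw [ae_restrict_iff' measurableSet_ball]
      filter_upwards [hw.2] with x hx hxB
      exact hx (hΩ (ball_subset_ball (by linarith) hxB))
    have ha := avg_pos w x0 ρ hρ hint hpos
    rw [meanFinite_one, meanFinite_coe _ _ (by linarith), pMean_one, pMean_coe _ _ (by linarith)]
    set a := ⨍ x in ball x0 ρ, w x with hadef
    have hfin : ENNReal.ofReal (a ^ (-δ)) * volume (ball x0 ρ) * K ≠ ⊤ :=
      ENNReal.mul_ne_top (ENNReal.mul_ne_top ENNReal.ofReal_ne_top measure_ball_lt_top.ne) hK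
    have hm : Measurable fun x => w x ^ (-δ) := hw.1.pow_const _
    have hnn : 0 ≤ᵐ[volume.restrict (ball x0 ρ)] fun x => w x ^ (-δ) :=
      hpos.mono fun x hx => Real.rpow_nonneg hx.le _
    have hI : IntegrableOn (fun x => w x ^ (-δ)) (ball x0 ρ) :=
      (lintegral_ofReal_ne_top_iff_integrable hm.aestronglyMeasurable hnn).1
        (ne_top_of_le_ne_top hfin hb)
    refine ⟨hI, hint, ?_⟩
    have hA := avg_pos (fun x => w x ^ (-δ)) x0 ρ hρ hI (hpos.mono fun x hx => Real.rpow_pos_of_pos hx _)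
    have hv : 0 < volume.real (ball x0 ρ) :=
      ENNReal.toReal_pos (measure_ball_pos _ _ hρ).ne' measure_ball_lt_top.ne
    have hle : ⨍ x in ball x0 ρ, w x ^ (-δ) ≤ K.toReal * a ^ (-δ) := by
      rw [setAverage_eq, smul_eq_mul, inv_mul_le_iff₀ hv, integral_eq_lintegral_of_nonneg_ae hnn
        hm.aestronglyMeasurable]
      refine (ENNReal.toReal_mono hfin hb).trans ?_
      rw [ENNReal.toReal_mul, ENNReal.toReal_mul, ENNReal.toReal_ofReal (by positivity)]
      rw [Measure.real]
      apply le_of_eq; ring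
    set A := ⨍ x in ball x0 ρ, w x ^ (-δ)
    have h1 : a = (a ^ (-δ)) ^ (1 / -δ) := by
      rw [← Real.rpow_mul ha.le, mul_one_div_cancel (by linarith), Real.rpow_one]
    have hK0 : 0 < K.toReal := by linarith
    have h2 : (K.toReal * a ^ (-δ)) ^ (1 / -δ) ≤ A ^ (1 / -δ) :=
      Real.rpow_le_rpow_of_nonpos hA hle (by rw [one_div_neg_eq_neg_one_div]; simp [hδ.le])
    rw [Real.mul_rpow hK0.le (by positivity), ← h1, one_div_neg_eq_neg_one_div,
      Real.rpow_neg hK0.le, inv_mul_le_iff₀ (by positivity)] at h2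
    rw [one_div_neg_eq_neg_one_div]
    exact h2
  choose q hq using key
  refine ⟨q, fun n hn Ω _ s hs w hw hRC => ?_⟩
  set c := RCconst Ω w 1 (s : EReal) with hc
  have hne : {C : ℝ | 1 ≤ C ∧ MemRC Ω w 1 (s : EReal) C}.Nonempty := hRC
  have hc1 : 1 ≤ c := le_csInf hne fun C hC => hC.1
  obtain ⟨h1, h2⟩ := hq n s c hn hs hc1
  refine ⟨h1, h2 Ω w hw ?_⟩
  obtain ⟨C, ⟨-, hC⟩, hlt⟩ := exists_lt_of_csInf_lt hne (lt_add_one c)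
  intro B hB
  obtain ⟨h3, h4, h5⟩ := hC B hB
  refine ⟨h3, h4, h5.trans ?_⟩
  have : 0 ≤ pMean w 1 B := by
    obtain ⟨x0, ρ, hρ, rfl, hΩ⟩ := hB
    rw [pMean_one]
    refine (avg_pos w x0 ρ hρ ((meanFinite_one _ _).1 h3) ?_).le
    rw [ae_restrict_iff' measurableSet_ball]
    filter_upwards [hw.2] with x hx hxB
    exact hx (hΩ (ball_subset_ball (by linarith) hxB))
  gcongr
end

section
/- (Theorem 5.2(iv).) For every weight w ∈ A_∞ there exists 1 < r < ∞, depending only on the dimension n and on [w]_{A_∞}, such that w ∈ A_r. -/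
open MeasureTheory

theorem jn_vol {n : ℕ} (x : EuclideanSpace ℝ (Fin n)) {r : ℝ} (hr : 0 ≤ r) :
    volume.real (Metric.closedBall x r) =
      r ^ n * volume.real (Metric.ball (0 : EuclideanSpace ℝ (Fin n)) 1) := by
  simpa using Measure.addHaar_real_closedBall (volume : Measure (EuclideanSpace ℝ (Fin n))) x hr

theorem jn_vol_pos {n : ℕ} (x : EuclideanSpace ℝ (Fin n)) {r : ℝ} (hr : 0 < r) :
    0 < volume.real (Metric.closedBall x r) :=
  ENNReal.toReal_pos (Metric.measure_closedBall_pos volume x hr).ne'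
    measure_closedBall_lt_top.ne

theorem jn_stop {n : ℕ} (x0 : EuclideanSpace ℝ (Fin n)) {ρ K l : ℝ} (hρ : 0 < ρ) (hK : 0 < K)
    (g : EuclideanSpace ℝ (Fin n) → ℝ) (hg0 : ∀ x, 0 ≤ g x)
    (hg : IntegrableOn g (Metric.closedBall x0 ρ))
    (hl : l = 2 * 16 ^ n * K)
    (hgK : ∫ x in Metric.closedBall x0 ρ, g x ≤ K * volume.real (Metric.closedBall x0 ρ)) :
    ∀ᵐ x, x ∈ Metric.closedBall x0 ρ → l < g x → ∃ y s, 0 < s ∧ 10 * s ≤ ρ ∧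
      y ∈ Metric.closedBall x0 ρ ∧ x ∈ Metric.closedBall y s ∧
      Metric.closedBall y s ⊆ Metric.closedBall x0 ρ ∧
      l * volume.real (Metric.closedBall y s) < ∫ x in Metric.closedBall y s, g x ∧
      ∫ x in Metric.closedBall y s, g x ≤ 2 ^ n * l * volume.real (Metric.closedBall y s) := by
  set B0 := Metric.closedBall x0 ρ with hB0
  have hint : Integrable (B0.indicator g) := hg.integrable_indicator measurableSet_closedBall
  have hlpos : 0 < l := by rw [hl]; positivity
  filter_upwards [IsUnifLocDoublingMeasure.ae_tendsto_average volume hint.locallyIntegrable 1]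
    with x hx hxB hlx
  set c : ℕ → EuclideanSpace ℝ (Fin n) := fun k => x + ((1/2 : ℝ)^k) • (x0 - x) with hc
  set d : ℕ → ℝ := fun k => (1/2 : ℝ)^k * ρ with hd
  have hdpos : ∀ k, 0 < d k := fun k => by positivity
  have hxd : dist x0 x ≤ ρ := by rw [dist_comm]; exact hxB
  have hmem : ∀ k, x ∈ Metric.closedBall (c k) (d k) := by
    intro k
    rw [Metric.mem_closedBall, dist_eq_norm]
    have : x - c k = -(((1/2 : ℝ)^k) • (x0 - x)) := by simp [hc]
    rw [this, norm_neg, norm_smul, ← dist_eq_norm]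
    rw [Real.norm_of_nonneg (by positivity)]
    exact mul_le_mul_of_nonneg_left hxd (by positivity)
  have hcd : ∀ k j, k ≤ j → dist (c j) (c k) ≤ d k - d j := by
    intro k j hkj
    have h1 : (1/2 : ℝ)^j ≤ (1/2)^k := pow_le_pow_of_le_one (by norm_num) (by norm_num) hkj
    rw [dist_comm, dist_eq_norm]
    have : c k - c j = ((1/2 : ℝ)^k - (1/2)^j) • (x0 - x) := by
      simp only [hc, sub_smul]; abel
    rw [this, norm_smul, Real.norm_of_nonneg (by linarith), ← dist_eq_norm]
    calc _ ≤ ((1/2 : ℝ)^k - (1/2)^j) * ρ := mul_le_mul_of_nonneg_left hxd (by linarith)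
      _ = _ := by simp only [hd]; ring
  have hsub : ∀ k j, k ≤ j → Metric.closedBall (c j) (d j) ⊆ Metric.closedBall (c k) (d k) := by
    intro k j hkj
    apply Metric.closedBall_subset_closedBall'
    linarith [hcd k j hkj]
  have hc0 : Metric.closedBall (c 0) (d 0) = B0 := by simp [hc, hd, hB0]
  have hsub0 : ∀ k, Metric.closedBall (c k) (d k) ⊆ B0 := fun k => hc0 ▸ hsub 0 k (Nat.zero_le _)
  have hvol : ∀ k, volume.real (Metric.closedBall (c k) (d k))
      = ((1/2 : ℝ)^k)^n * volume.real B0 := by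
    intro k
    rw [jn_vol _ (hdpos k).le, hB0, jn_vol _ hρ.le, hd, mul_pow]; ring
  have hVpos : 0 < volume.real B0 := jn_vol_pos x0 hρ
  have hex : ∃ k, l * volume.real (Metric.closedBall (c k) (d k)) <
      ∫ x in Metric.closedBall (c k) (d k), g x := by
    have hdt : Filter.Tendsto d Filter.atTop (nhdsWithin 0 (Set.Ioi 0)) := by
      rw [tendsto_nhdsWithin_iff]
      refine ⟨?_, Filter.Eventually.of_forall hdpos⟩
      have := (tendsto_pow_atTop_nhds_zero_of_lt_one (r := (1/2:ℝ)) (by norm_num)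
        (by norm_num)).mul_const ρ
      simpa [hd] using this
    have ht := hx c d hdt (Filter.Eventually.of_forall fun k => by rw [one_mul]; exact hmem k)
    rw [Set.indicator_of_mem hxB] at ht
    obtain ⟨k, hk⟩ := (ht.eventually (lt_mem_nhds hlx)).exists
    refine ⟨k, ?_⟩
    rw [setAverage_eq, smul_eq_mul, lt_inv_mul_iff₀ (jn_vol_pos _ (hdpos k)), mul_comm] at hk
    refine hk.trans_eq (setIntegral_congr_fun measurableSet_closedBall fun z hz => ?_)
    exact Set.indicator_of_mem (hsub0 k hz) g
  classical
  obtain ⟨k, hk, hmin⟩ : ∃ k, (l * volume.real (Metric.closedBall (c k) (d k)) <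
      ∫ x in Metric.closedBall (c k) (d k), g x) ∧ ∀ j < k,
      ¬ (l * volume.real (Metric.closedBall (c j) (d j)) <
      ∫ x in Metric.closedBall (c j) (d j), g x) :=
    ⟨Nat.find hex, Nat.find_spec hex, fun j hj => Nat.find_min hex hj⟩
  have hmono : ∀ {s t : Set (EuclideanSpace ℝ (Fin n))}, s ⊆ t → t ⊆ B0 →
      ∫ x in s, g x ≤ ∫ x in t, g x := by
    intro s t hst ht
    exact setIntegral_mono_set (hg.mono_set ht) (Filter.Eventually.of_forall hg0)
      (Filter.Eventually.of_forall hst)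
  have hk5 : 4 < k := by
    by_contra hcon
    push Not at hcon
    have h1 := hk.trans_le ((hmono (hsub0 k) subset_rfl).trans hgK)
    rw [hvol, ← mul_assoc, hl] at h1
    have h2 := lt_of_mul_lt_mul_right h1 hVpos.le
    have h3 : (1/16 : ℝ) ≤ (1/2)^k := by
      have : (1/2 : ℝ)^4 ≤ (1/2)^k := pow_le_pow_of_le_one (by norm_num) (by norm_num) hcon
      norm_num at this ⊢; exact this
    have h4 : (1/16 : ℝ)^n ≤ ((1/2)^k)^n := pow_le_pow_left₀ (by norm_num) h3 n
    have h5 : (16:ℝ)^n * (1/16)^n = 1 := by rw [← mul_pow]; norm_num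
    have h6 : (1:ℝ) ≤ 16^n * ((1/2)^k)^n := 
      h5.symm.le.trans (mul_le_mul_of_nonneg_left h4 (by positivity))
    nlinarith
  obtain ⟨j, rfl⟩ : ∃ j, k = j + 1 := ⟨k - 1, by omega⟩
  refine ⟨c (j+1), d (j+1), hdpos _, ?_, ?_, hmem _, hsub0 _, hk, ?_⟩
  · have : (1/2 : ℝ)^(j+1) ≤ (1/2)^4 := pow_le_pow_of_le_one (by norm_num) (by norm_num) hk5.le
    simp only [hd]
    nlinarith
  · exact hsub0 _ (Metric.mem_closedBall_self (hdpos _).le)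
  · have h1 := hmin j (Nat.lt_succ_self j)
    push Not at h1
    refine (hmono (hsub j (j+1) (Nat.le_succ j)) (hsub0 j)).trans (h1.trans_eq ?_)
    rw [hvol, hvol, pow_succ (1/2 : ℝ) j, mul_pow]
    have : (2:ℝ)^n * (1/2)^n = 1 := by rw [← mul_pow]; norm_num
    linear_combination (-l * ((1/2)^j)^n * volume.real B0) * this

theorem jn_main {n : ℕ} (Ω : Set (EuclideanSpace ℝ (Fin n))) {K l L : ℝ} (hK : 0 < K)
    (f : EuclideanSpace ℝ (Fin n) → ℝ)
    (hl : l = 2 * 16 ^ n * K) (hL : L = 5 ^ n * K + 2 ^ n * l)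
    (hf : ∀ x ρ, 0 < ρ → Metric.ball x (2 * ρ) ⊆ Ω → IntegrableOn f (Metric.closedBall x ρ))
    (hB : ∀ x ρ, 0 < ρ → Metric.ball x (2 * ρ) ⊆ Ω →
      ∫ y in Metric.closedBall x ρ, |f y - ⨍ z in Metric.closedBall x ρ, f z| ≤
        K * volume.real (Metric.closedBall x ρ)) (m : ℕ) :
    ∀ x ρ, 0 < ρ → Metric.ball x (2 * ρ) ⊆ Ω →
      volume {y | y ∈ Metric.closedBall x ρ ∧
        (m : ℝ) * L ≤ |f y - ⨍ z in Metric.closedBall x ρ, f z|} ≤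
        ENNReal.ofReal ((1/2) ^ m) * volume (Metric.closedBall x ρ) := by
  have hlpos : 0 < l := by rw [hl]; positivity
  have hLl : l < L := by
    have h1 : (1:ℝ) ≤ 2 ^ n := one_le_pow₀ (by norm_num)
    have h2 : 0 < (5:ℝ) ^ n * K := by positivity
    nlinarith
  induction m with
  | zero =>
    intro x ρ hρ hΩ
    simp only [pow_zero, ENNReal.ofReal_one, one_mul]
    exact measure_mono fun y hy => hy.1
  | succ m ih =>
    intro x0 ρ hρ hΩ
    set B0 := Metric.closedBall x0 ρ with hB0
    set a := ⨍ z in B0, f z with ha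
    have hfB := hf x0 ρ hρ hΩ
    have hcst : ∀ (b : ℝ) (y : EuclideanSpace ℝ (Fin n)) (s : ℝ),
        IntegrableOn (fun _ => b) (Metric.closedBall y s) := fun b y s =>
      integrableOn_const measure_closedBall_lt_top.ne
    have hgi : IntegrableOn (fun y => |f y - a|) B0 := (hfB.sub (hcst a x0 ρ)).abs
    have hgK := hB x0 ρ hρ hΩ
    have hst := jn_stop x0 hρ hK (fun y => |f y - a|) (fun _ => abs_nonneg _) hgi hl hgK
    set T : Set (EuclideanSpace ℝ (Fin n)) := {x | ∃ y s, 0 < s ∧ 10 * s ≤ ρ ∧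
      y ∈ Metric.closedBall x0 ρ ∧ x ∈ Metric.closedBall y s ∧
      Metric.closedBall y s ⊆ Metric.closedBall x0 ρ ∧
      l * volume.real (Metric.closedBall y s) < ∫ x in Metric.closedBall y s, |f x - a| ∧
      ∫ x in Metric.closedBall y s, |f x - a| ≤
        2 ^ n * l * volume.real (Metric.closedBall y s)} with hT
    have hTc : ∀ x : T, ∃ y s, 0 < s ∧ 10 * s ≤ ρ ∧
      y ∈ Metric.closedBall x0 ρ ∧ (x : EuclideanSpace ℝ (Fin n)) ∈ Metric.closedBall y s ∧
      Metric.closedBall y s ⊆ Metric.closedBall x0 ρ ∧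
      l * volume.real (Metric.closedBall y s) < ∫ x in Metric.closedBall y s, |f x - a| ∧
      ∫ x in Metric.closedBall y s, |f x - a| ≤
        2 ^ n * l * volume.real (Metric.closedBall y s) := fun x => x.2
    choose y s hs0 hs10 hyB hxy hsub hlow hup using hTc
    obtain ⟨u, -, hdisj, hcov⟩ := Vitali.exists_disjoint_subfamily_covering_enlargement_closedBall
      Set.univ y s ρ (fun t _ => by linarith [hs10 t, hs0 t]) 5 (by norm_num)
    have huc : u.Countable := hdisj.countable_of_nonempty_interior fun i _ =>
      (Metric.nonempty_ball.2 (hs0 i)).mono Metric.ball_subset_interior_closedBall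
    have hadm : ∀ t : T, Metric.ball (y t) (2 * (5 * s t)) ⊆ Ω := by
      intro t
      refine subset_trans (Metric.ball_subset_ball' ?_) hΩ
      have := Metric.mem_closedBall.1 (hyB t)
      linarith [hs10 t]
    have hs5 : ∀ t : T, 0 < 5 * s t := fun t => by linarith [hs0 t]
    have hsub5 : ∀ t : T, Metric.closedBall (y t) (s t) ⊆ Metric.closedBall (y t) (5 * s t) :=
      fun t => Metric.closedBall_subset_closedBall (by linarith [hs0 t])
    have hvol5 : ∀ t : T, volume.real (Metric.closedBall (y t) (5 * s t)) =
        5 ^ n * volume.real (Metric.closedBall (y t) (s t)) := by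
      intro t
      rw [jn_vol _ (hs5 t).le, jn_vol _ (hs0 t).le, mul_pow, mul_assoc]
    have hdiff : ∀ t : T, |(⨍ z in Metric.closedBall (y t) (5 * s t), f z) - a| ≤ L := by
      intro t
      set b := ⨍ z in Metric.closedBall (y t) (5 * s t), f z with hb
      have hV := jn_vol_pos (y t) (hs0 t)
      have hf5 := hf (y t) (5 * s t) (hs5 t) (hadm t)
      have hi5 : IntegrableOn (fun z => |f z - b|) (Metric.closedBall (y t) (5 * s t)) :=
        (hf5.sub (hcst b _ _)).abs
      have h1 : ∫ z in Metric.closedBall (y t) (s t), |f z - b| ≤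
          K * (5 ^ n * volume.real (Metric.closedBall (y t) (s t))) := by
        rw [← hvol5]
        refine le_trans ?_ (hB (y t) (5 * s t) (hs5 t) (hadm t))
        exact setIntegral_mono_set hi5 (Filter.Eventually.of_forall fun _ => abs_nonneg _)
          (Filter.Eventually.of_forall (hsub5 t))
      have h2 : ∫ z in Metric.closedBall (y t) (s t), |b - a| ≤
          ∫ z in Metric.closedBall (y t) (s t), (|f z - b| + |f z - a|) := by
        refine setIntegral_mono (hcst _ _ _)
          ((hi5.mono_set (hsub5 t)).add (hgi.mono_set (hsub t))) fun z => ?_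
        have := abs_sub_le b (f z) a
        rwa [abs_sub_comm b (f z)] at this
      rw [integral_add (hi5.mono_set (hsub5 t)) (hgi.mono_set (hsub t)), setIntegral_const,
        smul_eq_mul] at h2
      have h3 := hup t
      rw [hL]
      refine le_of_mul_le_mul_left ?_ hV
      linarith
    -- the covering
    have hcover : ∀ᵐ x, x ∈ {y | y ∈ B0 ∧ ((m + 1 : ℕ) : ℝ) * L ≤ |f y - a|} →
        x ∈ ⋃ t ∈ u, {z | z ∈ Metric.closedBall (y t) (5 * s t) ∧
          (m : ℝ) * L ≤ |f z - ⨍ z in Metric.closedBall (y t) (5 * s t), f z|} := by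
      filter_upwards [hst] with x hx hxS
      obtain ⟨hxB, hxL⟩ := hxS
      push_cast at hxL
      have hmL : 0 ≤ (m : ℝ) * L := by have := hlpos.trans hLl; positivity
      have hxT : x ∈ T := hx hxB (by linarith)
      obtain ⟨t, htu, ht⟩ := hcov ⟨x, hxT⟩ (Set.mem_univ _)
      simp only [Set.mem_iUnion]
      refine ⟨t, htu, ht (hxy ⟨x, hxT⟩), ?_⟩
      have h1 := hdiff t
      have h2 := abs_sub_le (f x) (⨍ z in Metric.closedBall (y t) (5 * s t), f z) a
      linarith
    have hsum : ENNReal.ofReal l * ∑' t : u, volume (Metric.closedBall (y t) (s t)) ≤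
        ENNReal.ofReal (K * volume.real B0) := by
      have : Countable u := huc.to_subtype
      rw [← ENNReal.tsum_mul_left]
      calc ∑' t : u, ENNReal.ofReal l * volume (Metric.closedBall (y t) (s t))
          ≤ ∑' t : u, ∫⁻ z in Metric.closedBall (y t) (s t), ENNReal.ofReal |f z - a| := by
            refine ENNReal.tsum_le_tsum fun t => ?_
            rw [← ofReal_integral_eq_lintegral_ofReal (hgi.mono_set (hsub t))
              (Filter.Eventually.of_forall fun _ => abs_nonneg _)]
            rw [← ofReal_measureReal measure_closedBall_lt_top.ne,
              ← ENNReal.ofReal_mul hlpos.le]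
            exact ENNReal.ofReal_le_ofReal (hlow t).le
        _ = ∫⁻ z in ⋃ t : u, Metric.closedBall (y t) (s t), ENNReal.ofReal |f z - a| := by
            rw [lintegral_iUnion (fun _ => measurableSet_closedBall)]
            intro i j hij
            exact hdisj i.2 j.2 (fun h => hij (Subtype.ext h))
        _ ≤ ∫⁻ z in B0, ENNReal.ofReal |f z - a| :=
            lintegral_mono_set (Set.iUnion_subset fun t => hsub t)
        _ ≤ _ := by
            rw [← ofReal_integral_eq_lintegral_ofReal hgi
              (Filter.Eventually.of_forall fun _ => abs_nonneg _)]
            exact ENNReal.ofReal_le_ofReal hgK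
    have hl5 : 2 * 5 ^ n * K ≤ l := by
      rw [hl]
      have : (5:ℝ) ^ n ≤ 16 ^ n := pow_le_pow_left₀ (by norm_num) (by norm_num) n
      nlinarith
    have hsum2 : ENNReal.ofReal (5 ^ n) * ∑' t : u, volume (Metric.closedBall (y t) (s t)) ≤
        ENNReal.ofReal (1/2) * volume B0 := by
      have h1 : ENNReal.ofReal (2 * K) * (ENNReal.ofReal (5 ^ n) *
          ∑' t : u, volume (Metric.closedBall (y t) (s t))) ≤
          ENNReal.ofReal (2 * K) * (ENNReal.ofReal (1/2) * volume B0) := by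
        rw [← mul_assoc, ← mul_assoc, ← ENNReal.ofReal_mul (by positivity),
          ← ENNReal.ofReal_mul (by positivity)]
        have e1 : 2 * K * (1/2) = K := by ring
        rw [e1]
        calc _ ≤ ENNReal.ofReal l * ∑' t : u, volume (Metric.closedBall (y t) (s t)) := by
              gcongr
              linarith
          _ ≤ _ := hsum
          _ = _ := by
              rw [ENNReal.ofReal_mul hK.le, ofReal_measureReal measure_closedBall_lt_top.ne]
      rwa [ENNReal.mul_le_mul_iff_right (by simpa using hK) ENNReal.ofReal_ne_top] at h1
    calc volume {y | y ∈ B0 ∧ ((m + 1 : ℕ) : ℝ) * L ≤ |f y - a|}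
        ≤ volume (⋃ t ∈ u, {z | z ∈ Metric.closedBall (y t) (5 * s t) ∧
          (m : ℝ) * L ≤ |f z - ⨍ z in Metric.closedBall (y t) (5 * s t), f z|}) :=
          measure_mono_ae hcover
      _ ≤ ∑' t : u, volume {z | z ∈ Metric.closedBall (y t) (5 * s t) ∧
          (m : ℝ) * L ≤ |f z - ⨍ z in Metric.closedBall (y t) (5 * s t), f z|} :=
          measure_biUnion_le _ huc _
      _ ≤ ∑' t : u, ENNReal.ofReal ((1/2) ^ m) *
          (ENNReal.ofReal (5 ^ n) * volume (Metric.closedBall (y t) (s t))) := by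
          refine ENNReal.tsum_le_tsum fun t => ?_
          refine (ih (y t) (5 * s t) (hs5 t) (hadm t)).trans_eq ?_
          congr 1
          rw [← ofReal_measureReal measure_closedBall_lt_top.ne, hvol5,
            ENNReal.ofReal_mul (by positivity), ofReal_measureReal measure_closedBall_lt_top.ne]
      _ = ENNReal.ofReal ((1/2) ^ m) * (ENNReal.ofReal (5 ^ n) *
          ∑' t : u, volume (Metric.closedBall (y t) (s t))) := by
          rw [ENNReal.tsum_mul_left, ENNReal.tsum_mul_left]
      _ ≤ ENNReal.ofReal ((1/2) ^ m) * (ENNReal.ofReal (1/2) * volume B0) := by gcongr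
      _ = _ := by
          rw [← mul_assoc, ← ENNReal.ofReal_mul (by positivity), pow_succ]

theorem jn_exp {n : ℕ} (B : Set (EuclideanSpace ℝ (Fin n)))
    {L ε : ℝ} (hL : 0 < L)
    (hε : ε = Real.log (3/2) / L) (g : EuclideanSpace ℝ (Fin n) → ℝ) (hg : Measurable g)
    (h : ∀ m : ℕ, volume {y | y ∈ B ∧ (m : ℝ) * L ≤ |g y|} ≤
      ENNReal.ofReal ((1/2) ^ m) * volume B) :
    ∫⁻ y in B, ENNReal.ofReal (Real.exp (ε * |g y|)) ≤ ENNReal.ofReal 6 * volume B := by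
  have hlog : 0 < Real.log (3/2) := Real.log_pos (by norm_num)
  have hms : ∀ m : ℕ, MeasurableSet {y | (m : ℝ) * L ≤ |g y|} := fun m =>
    measurableSet_le measurable_const hg.abs
  calc ∫⁻ y in B, ENNReal.ofReal (Real.exp (ε * |g y|))
      ≤ ∫⁻ y in B, ∑' m : ℕ, ({y | (m : ℝ) * L ≤ |g y|}).indicator
          (fun _ => ENNReal.ofReal ((3/2) ^ (m+1))) y := by
        refine lintegral_mono fun y => ?_
        set m := ⌊|g y| / L⌋₊ with hm
        have h1 : (m : ℝ) ≤ |g y| / L := Nat.floor_le (by positivity)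
        have h2 : |g y| / L < m + 1 := Nat.lt_floor_add_one _
        have h3 : y ∈ {y | (m : ℝ) * L ≤ |g y|} := by
          rw [le_div_iff₀ hL] at h1; exact h1
        refine le_trans ?_ (ENNReal.le_tsum m)
        rw [Set.indicator_of_mem h3]
        apply ENNReal.ofReal_le_ofReal
        have h4 : ((3/2 : ℝ)) ^ (m+1) = Real.exp (Real.log (3/2) * (m + 1)) := by
          rw [← Real.rpow_natCast, Real.rpow_def_of_pos (by norm_num)]; push_cast; rfl
        rw [h4]
        apply Real.exp_le_exp.2
        rw [hε, div_mul_eq_mul_div, mul_div_assoc]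
        exact mul_le_mul_of_nonneg_left h2.le hlog.le
    _ = ∑' m : ℕ, ENNReal.ofReal ((3/2) ^ (m+1)) *
          volume {y | y ∈ B ∧ (m : ℝ) * L ≤ |g y|} := by
        rw [lintegral_tsum fun m => (measurable_const.indicator (hms m)).aemeasurable]
        refine tsum_congr fun m => ?_
        rw [lintegral_indicator_const (hms m), Measure.restrict_apply (hms m), Set.inter_comm]
        rfl
    _ ≤ ∑' m : ℕ, ENNReal.ofReal (3/2 * (3/4) ^ m) * volume B := by
        refine ENNReal.tsum_le_tsum fun m => ?_
        refine (mul_le_mul_right (h m) _).trans_eq ?_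
        rw [← mul_assoc, ← ENNReal.ofReal_mul (by positivity), pow_succ, mul_right_comm, ← mul_pow]
        norm_num [mul_comm]
    _ = _ := by
        rw [ENNReal.tsum_mul_right, ← ENNReal.ofReal_tsum_of_nonneg (fun m => by positivity)
          ((summable_geometric_of_lt_one (by norm_num) (by norm_num)).mul_left _),
          tsum_mul_left, tsum_geometric_of_lt_one (by norm_num) (by norm_num)]
        norm_num

theorem jn_ball {n : ℕ} (x : EuclideanSpace ℝ (Fin n)) {ρ : ℝ} (hρ : 0 < ρ) :
    volume.restrict (Metric.ball x ρ) = volume.restrict (Metric.closedBall x ρ) := by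
  refine Measure.restrict_congr_set ?_
  refine Filter.EventuallyLE.antisymm (Filter.Eventually.of_forall Metric.ball_subset_closedBall) ?_
  rw [ae_le_set, Metric.closedBall_sdiff_ball]
  exact Measure.addHaar_sphere_of_ne_zero volume x hρ.ne'

theorem jn_bmo {n : ℕ} (B : Set (EuclideanSpace ℝ (Fin n))) (hv : 0 < volume.real B)
    (hfin : volume B ≠ ⊤) (w : EuclideanSpace ℝ (Fin n) → ℝ) {C : ℝ}
    (hw : ∀ᵐ x ∂(volume.restrict B), 0 < w x)
    (hi : IntegrableOn (fun x => Real.log (w x)) B) (hi1 : IntegrableOn w B)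
    (hC : ⨍ x in B, w x ≤ C * Real.exp (⨍ x in B, Real.log (w x))) :
    ∫ y in B, |Real.log (w y) - ⨍ z in B, Real.log (w z)| ≤ 2 * C * volume.real B := by
  set a := ⨍ z in B, Real.log (w z) with ha
  have : IsFiniteMeasure (volume.restrict B) := ⟨by simpa using hfin.lt_top⟩
  have hia : IntegrableOn (fun y => Real.log (w y) - a) B := hi.sub (integrable_const a)
  have hi2 : IntegrableOn (fun y => 2 * Real.exp (-a) * w y) B := Integrable.const_mul hi1 _
  have h1 : ∫ y in B, |Real.log (w y) - a| ≤
      ∫ y in B, (2 * Real.exp (-a) * w y - (Real.log (w y) - a)) := by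
    refine integral_mono_ae hia.abs (hi2.sub hia) ?_
    filter_upwards [hw] with y hy
    have e : Real.exp (Real.log (w y) - a) = Real.exp (-a) * w y := by
      rw [sub_eq_neg_add, Real.exp_add, Real.exp_log hy]
    have h2 := Real.add_one_le_exp (Real.log (w y) - a)
    have h3 := Real.exp_pos (Real.log (w y) - a)
    rw [e] at h2 h3
    rcases abs_cases (Real.log (w y) - a) with ⟨h, _⟩ | ⟨h, _⟩ <;> simp only [h] <;> linarith
  rw [integral_sub hi2 hia, integral_sub_average, integral_const_mul, sub_zero] at h1
  refine h1.trans ?_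
  rw [setAverage_eq, smul_eq_mul, inv_mul_le_iff₀ hv] at hC
  have h4 := mul_le_mul_of_nonneg_left hC (show 0 ≤ 2 * Real.exp (-a) by positivity)
  refine h4.trans_eq ?_
  have : Real.exp (-a) * Real.exp a = 1 := by rw [← Real.exp_add]; simp
  linear_combination (2 * volume.real B * C) * this

theorem jn_final {n : ℕ} (B : Set (EuclideanSpace ℝ (Fin n))) (hv : 0 < volume.real B)
    (hfin : volume B ≠ ⊤) (w : EuclideanSpace ℝ (Fin n) → ℝ) {ε : ℝ} (hε : 0 < ε)
    (hwm : Measurable w)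
    (hw : ∀ᵐ x ∂(volume.restrict B), 0 < w x) (a : ℝ)
    (h : ∫⁻ y in B, ENNReal.ofReal (Real.exp (ε * |Real.log (w y) - a|)) ≤
      ENNReal.ofReal 6 * volume B) :
    IntegrableOn (fun x => w x ^ (-ε)) B ∧
      Real.exp a ≤ 6 ^ (1/ε) * (⨍ x in B, w x ^ (-ε)) ^ (1 / (-ε)) := by
  have : IsFiniteMeasure (volume.restrict B) := ⟨by simpa using hfin.lt_top⟩
  have hm : Measurable fun y => Real.exp (ε * |Real.log (w y) - a|) := by fun_prop
  have hpt : ∀ᵐ x ∂(volume.restrict B), w x ^ (-ε) ≤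
      Real.exp (-ε * a) * Real.exp (ε * |Real.log (w x) - a|) := by
    filter_upwards [hw] with x hx
    rw [Real.rpow_def_of_pos hx, ← Real.exp_add]
    apply Real.exp_le_exp.2
    have := neg_abs_le (Real.log (w x) - a)
    nlinarith
  have hie : IntegrableOn (fun y => Real.exp (ε * |Real.log (w y) - a|)) B := by
    refine ⟨hm.aestronglyMeasurable, ?_⟩
    rw [hasFiniteIntegral_iff_ofReal (Filter.Eventually.of_forall fun _ => (Real.exp_pos _).le)]
    exact h.trans_lt (ENNReal.mul_lt_top ENNReal.ofReal_lt_top hfin.lt_top)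
  have hile : ∫ y in B, Real.exp (ε * |Real.log (w y) - a|) ≤ 6 * volume.real B := by
    rw [integral_eq_lintegral_of_nonneg_ae
      (Filter.Eventually.of_forall fun _ => (Real.exp_pos _).le) hm.aestronglyMeasurable]
    refine (ENNReal.toReal_mono (ENNReal.mul_ne_top ENNReal.ofReal_ne_top hfin) h).trans_eq ?_
    simp [measureReal_def]
  have hi : IntegrableOn (fun x => w x ^ (-ε)) B := by
    refine Integrable.mono' (hie.const_mul (Real.exp (-ε * a)))
      (hwm.pow_const _).aestronglyMeasurable ?_
    filter_upwards [hpt, hw] with x hx hx0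
    rwa [Real.norm_of_nonneg (Real.rpow_pos_of_pos hx0 _).le]
  refine ⟨hi, ?_⟩
  have hle : ⨍ x in B, w x ^ (-ε) ≤ Real.exp (-ε * a) * 6 := by
    rw [setAverage_eq, smul_eq_mul, inv_mul_le_iff₀ hv]
    refine (integral_mono_ae hi (hie.const_mul _) hpt).trans ?_
    rw [integral_const_mul]
    have := mul_le_mul_of_nonneg_left hile (Real.exp_pos (-ε * a)).le
    linarith
  have hpos : 0 < ⨍ x in B, w x ^ (-ε) := by
    rw [setAverage_eq, smul_eq_mul]
    refine mul_pos (inv_pos.2 hv) ?_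
    have h0 : 0 ≤ᵐ[volume.restrict B] fun x => w x ^ (-ε) := by
      filter_upwards [hw] with x hx using (Real.rpow_pos_of_pos hx _).le
    rw [integral_pos_iff_support_of_nonneg_ae h0 hi]
    have hs : (Function.support fun x => w x ^ (-ε)) =ᵐ[volume.restrict B] Set.univ := by
      rw [Filter.eventuallyEq_set]
      filter_upwards [hw] with x hx
      simp [(Real.rpow_pos_of_pos hx (-ε)).ne']
    rw [measure_congr hs, Measure.restrict_apply_univ]
    exact (ENNReal.toReal_pos_iff.1 hv).1
  have h2 := Real.rpow_le_rpow_of_nonpos hpos hle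
    (show 1 / (-ε) ≤ 0 by rw [one_div, inv_nonpos]; linarith)
  rw [Real.mul_rpow (Real.exp_pos _).le (by norm_num), ← Real.exp_mul] at h2
  have e1 : -ε * a * (1 / -ε) = a := by field_simp
  have e2 : (6:ℝ) ^ (1/ε) * 6 ^ (1 / -ε) = 1 := by
    rw [← Real.rpow_add (by norm_num)]
    have : 1/ε + 1/(-ε) = 0 := by field_simp; ring
    rw [this, Real.rpow_zero]
  rw [e1] at h2
  have h3 := mul_le_mul_of_nonneg_left h2 (show 0 ≤ (6:ℝ) ^ (1/ε) by positivity)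
  refine le_trans (le_of_eq ?_) h3
  linear_combination (-Real.exp a) * e2

/-- **Theorem 5.2(iv).** For every `w ∈ A_∞ = RC(0,1)` there exists `1 < r < ∞`, depending only
on the dimension `n` and on `[w]_{A_∞}`, such that `w ∈ A_r`. -/
theorem ainf_implies_ar :
    ∃ r : ℕ → ℝ → ℝ,
      ∀ (n : ℕ), 1 ≤ n → ∀ (Ω : Set (EuclideanSpace ℝ (Fin n))), IsOpen Ω →
      ∀ w : EuclideanSpace ℝ (Fin n) → ℝ, IsWeight Ω w →
      InRC Ω w 0 1 →
      1 < r n (RCconst Ω w 0 1) ∧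
      InRC Ω w ((1 / (1 - r n (RCconst Ω w 0 1)) : ℝ) : EReal) 1 := by
  refine ⟨fun n c => 1 + 1 / (Real.log (3/2) / (5 ^ n * (2 * (c + 1)) +
    2 ^ n * (2 * 16 ^ n * (2 * (c + 1))))), ?_⟩
  intro n _ Ω _ w hw hRC
  set c := RCconst Ω w 0 1 with hc
  have hne : {C : ℝ | 1 ≤ C ∧ MemRC Ω w 0 1 C}.Nonempty := hRC
  have hc1 : 1 ≤ c := le_csInf hne fun C hC => hC.1
  obtain ⟨C, ⟨hC1, hC⟩, hCc⟩ := exists_lt_of_csInf_lt hne (show _ < c + 1 from lt_add_one c)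
  set K := 2 * (c + 1) with hK
  set l := 2 * 16 ^ n * K with hl
  set L := 5 ^ n * K + 2 ^ n * l with hL
  have hKpos : 0 < K := by linarith
  have hLpos : 0 < L := by positivity
  set ε := Real.log (3/2) / L with hε
  have hεpos : 0 < ε := div_pos (Real.log_pos (by norm_num)) hLpos
  have hexp : 1 / (1 - (1 + 1 / ε)) = -ε := by field_simp; ring
  change 1 < 1 + 1 / ε ∧ InRC Ω w ((1 / (1 - (1 + 1 / ε)) : ℝ) : EReal) 1
  rw [hexp]
  refine ⟨by have : 0 < 1 / ε := by positivity
             linarith, ?_⟩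
  have h01 : (0 : EReal) ≠ ⊤ ∧ (0 : EReal) ≠ ⊥ := by simp
  have h11 : (1 : EReal) ≠ ⊤ ∧ (1 : EReal) ≠ ⊥ ∧ (1 : EReal) ≠ 0 :=
    ⟨EReal.coe_ne_top 1, EReal.coe_ne_bot 1, by simp⟩
  have he1 : ((-ε : ℝ) : EReal) ≠ ⊤ ∧ ((-ε : ℝ) : EReal) ≠ ⊥ ∧ ((-ε : ℝ) : EReal) ≠ 0 :=
    ⟨EReal.coe_ne_top _, EReal.coe_ne_bot _, by
      rw [Ne, EReal.coe_eq_zero]; linarith⟩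
  have hdata : ∀ x ρ, 0 < ρ → Metric.ball x (2 * ρ) ⊆ Ω →
      IntegrableOn (fun x => Real.log (w x)) (Metric.closedBall x ρ) ∧
      IntegrableOn w (Metric.closedBall x ρ) ∧
      ⨍ y in Metric.closedBall x ρ, w y ≤
        C * Real.exp (⨍ y in Metric.closedBall x ρ, Real.log (w y)) := by
    intro x ρ hρ hΩ
    have h := hC _ ⟨x, ρ, hρ, rfl, hΩ⟩
    simp only [MeanFinite, pMean, h01, h11, if_true, if_false, EReal.toReal_one, Real.rpow_one,
      div_one, IntegrableOn, jn_ball x hρ] at h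
    exact h
  have hwpos : ∀ x ρ, 0 < ρ → Metric.ball x (2 * ρ) ⊆ Ω →
      ∀ᵐ y ∂(volume.restrict (Metric.closedBall x ρ)), 0 < w y := by
    intro x ρ hρ hΩ
    rw [ae_restrict_iff' measurableSet_closedBall]
    filter_upwards [hw.2] with y hy hyB
    exact hy (hΩ (Metric.closedBall_subset_ball (by linarith) hyB))
  have hbmo : ∀ x ρ, 0 < ρ → Metric.ball x (2 * ρ) ⊆ Ω →
      ∫ y in Metric.closedBall x ρ, |Real.log (w y) -
        ⨍ z in Metric.closedBall x ρ, Real.log (w z)| ≤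
        K * volume.real (Metric.closedBall x ρ) := by
    intro x ρ hρ hΩ
    obtain ⟨h1, h2, h3⟩ := hdata x ρ hρ hΩ
    refine (jn_bmo _ (jn_vol_pos x hρ) measure_closedBall_lt_top.ne w
      (hwpos x ρ hρ hΩ) h1 h2 h3).trans ?_
    exact mul_le_mul_of_nonneg_right (by linarith) (jn_vol_pos x hρ).le
  have hjn := jn_main Ω hKpos (fun x => Real.log (w x)) hl hL
    (fun x ρ hρ hΩ => (hdata x ρ hρ hΩ).1) hbmo
  have h6 : (1:ℝ) ≤ 6 ^ (1/ε) := Real.one_le_rpow (by norm_num) (by positivity)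
  refine ⟨C * 6 ^ (1/ε), one_le_mul_of_one_le_of_one_le hC1 h6, ?_⟩
  rintro B ⟨x, ρ, hρ, rfl, hΩ⟩
  obtain ⟨h1, h2, h3⟩ := hdata x ρ hρ hΩ
  have hfin := jn_final _ (jn_vol_pos x hρ) measure_closedBall_lt_top.ne w hεpos hw.1
    (hwpos x ρ hρ hΩ) _ (jn_exp _ hLpos hε
      (fun y => Real.log (w y) - ⨍ z in Metric.closedBall x ρ, Real.log (w z))
      ((Real.measurable_log.comp hw.1).sub_const _) (fun m => hjn m x ρ hρ hΩ))
  simp only [MeanFinite, pMean, he1, h11, if_false, EReal.toReal_one, EReal.toReal_coe,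
    Real.rpow_one, div_one, IntegrableOn, jn_ball x hρ]
  refine ⟨hfin.1, h2, h3.trans ?_⟩
  rw [mul_assoc]
  exact mul_le_mul_of_nonneg_left hfin.2 (by linarith)
end
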